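/- arXiv:1011.1768 — 11 statements merged into one kernel-verified Lean document; each statement's English description precedes it below -/
import Mathlib

section
/- Let d ≥ 1, let R : ℝ^d × ℝ → ℝ be continuous, let I : [0,∞) → ℝ, and let u : [0,∞) × ℝ^d → ℝ be continuously differentiable and satisfy the Hamilton–Jacobi equation ∂ₜu(t,x) = R(x, I(t)) + |∇ₓu(t,x)|² for all t > 0 and x ∈ ℝ^d. Let x̄ : [0,∞) → ℝ^d be differentiable and suppose that for every t ≥ 0 one has max_{x ∈ ℝ^d} u(t,x) = 0 = u(t, x̄(t)). Then R(x̄(t), I(t)) = 0 for every t > 0. -/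
/-- For a `C¹` solution `u` of the constrained Hamilton–Jacobi equation
`∂ₜu(t,x) = R(x, I(t)) + |∇ₓu(t,x)|²` whose maximum over `x` equals `0` and is
attained at `xbar(t)` (with `xbar` differentiable), the growth rate vanishes at the
concentration point: `R(xbar(t), I(t)) = 0` for every `t > 0`. -/
theorem constrained_HJ_fitness_vanishes (d : ℕ) (hd : 1 ≤ d)
    (R : EuclideanSpace ℝ (Fin d) × ℝ → ℝ) (hR : Continuous R)
    (I : ℝ → ℝ)
    (u : ℝ × EuclideanSpace ℝ (Fin d) → ℝ) (hu : ContDiff ℝ 1 u)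
    (heq : ∀ t > (0:ℝ), ∀ x, deriv (fun s => u (s, x)) t
      = R (x, I t) + ‖gradient (fun y => u (t, y)) x‖ ^ 2)
    (xbar : ℝ → EuclideanSpace ℝ (Fin d))
    (hxbar : ∀ t ≥ (0:ℝ), DifferentiableAt ℝ xbar t)
    (hmax : ∀ t ≥ (0:ℝ), (∀ x, u (t, x) ≤ 0) ∧ u (t, xbar t) = 0) :
    ∀ t > (0:ℝ), R (xbar t, I t) = 0 := by
  intro t ht
  have h1 : IsLocalMax (fun s => u (s, xbar t)) t := by
    filter_upwards [Ioi_mem_nhds ht] with s hs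
    have hs' : (0:ℝ) < s := hs
    simpa only [(hmax t ht.le).2] using (hmax s hs'.le).1 (xbar t)
  have h2 : IsLocalMax (fun y => u (t, y)) (xbar t) := by
    refine Filter.Eventually.of_forall fun y => ?_
    simpa only [(hmax t ht.le).2] using (hmax t ht.le).1 y
  have h := heq t ht (xbar t)
  rw [h1.deriv_eq_zero] at h
  simp only [gradient, h2.fderiv_eq_zero, map_zero, norm_zero] at h
  linarith
end

section
/- Let d ≥ 1, let R : ℝ^d × ℝ → ℝ be continuously differentiable in its first variable, let I : [0,∞) → ℝ, and let u : (0,∞) × ℝ^d → ℝ be twice continuously differentiable (jointly in (t,x)) and satisfy the Hamilton–Jacobi equation ∂ₜu(t,x) = R(x, I(t)) + |∇ₓu(t,x)|² for all t > 0 and x ∈ ℝ^d. Let x̄ : (0,∞) → ℝ^d be differentiable and suppose that for each t the function u(t,·) attains a global maximum at x̄(t), and that the spatial Hessian matrix D²ₓu(t, x̄(t)) is invertible. Then x̄ satisfies the canonical equation: for all t > 0, x̄'(t) = (−D²ₓu(t, x̄(t)))⁻¹ · ∇ₓR(x̄(t), I(t)). -/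
/-- The spatial Hessian of `f` at `x`, as a continuous linear map. -/
noncomputable def hessAt {d : ℕ} (f : EuclideanSpace ℝ (Fin d) → ℝ)
    (x : EuclideanSpace ℝ (Fin d)) :
    EuclideanSpace ℝ (Fin d) →L[ℝ] EuclideanSpace ℝ (Fin d) :=
  fderiv ℝ (gradient f) x

/-- For a `C²` solution `u` of `∂ₜu = R(x, I(t)) + |∇ₓu|²` on `(0,∞) × ℝ^d`,
if `u(t,·)` attains a global maximum at `x̄(t)` (with `x̄` differentiable) and the
spatial Hessian `D²ₓu(t, x̄(t))` is invertible, then the canonical equation holds: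
`x̄'(t) = (−D²ₓu(t, x̄(t)))⁻¹ · ∇ₓR(x̄(t), I(t))` for all `t > 0`. -/
theorem canonical_equation (d : ℕ) (hd : 1 ≤ d)
    (R : EuclideanSpace ℝ (Fin d) × ℝ → ℝ)
    (hR : ∀ I : ℝ, ContDiff ℝ 1 (fun x => R (x, I)))
    (I : ℝ → ℝ)
    (u : ℝ × EuclideanSpace ℝ (Fin d) → ℝ)
    (hu : ContDiffOn ℝ 2 u (Set.Ioi (0:ℝ) ×ˢ Set.univ))
    (heq : ∀ t > (0:ℝ), ∀ x, deriv (fun s => u (s, x)) t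
      = R (x, I t) + ‖gradient (fun y => u (t, y)) x‖ ^ 2)
    (xbar : ℝ → EuclideanSpace ℝ (Fin d))
    (hxbar : ∀ t > (0:ℝ), DifferentiableAt ℝ xbar t)
    (hmax : ∀ t > (0:ℝ), ∀ x, u (t, x) ≤ u (t, xbar t))
    (hinv : ∀ t > (0:ℝ), IsUnit (hessAt (fun y => u (t, y)) (xbar t))) :
    ∀ t > (0:ℝ), deriv xbar t =
      Ring.inverse (-(hessAt (fun y => u (t, y)) (xbar t)))
        (gradient (fun y => R (y, I t)) (xbar t)) := by
  intro t ht
  have hopen : IsOpen (Set.Ioi (0:ℝ) ×ˢ (Set.univ : Set (EuclideanSpace ℝ (Fin d)))) :=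
    isOpen_Ioi.prod isOpen_univ
  have hC : ∀ s > (0:ℝ), ∀ x, ContDiffAt ℝ 2 u (s, x) := fun s hs x =>
    hu.contDiffAt (hopen.mem_nhds ⟨hs, Set.mem_univ _⟩)
  have hdu : ∀ s > (0:ℝ), ∀ x, HasFDerivAt u (fderiv ℝ u (s, x)) (s, x) := fun s hs x =>
    ((hC s hs x).differentiableAt (by norm_num)).hasFDerivAt
  have hspace : ∀ s > (0:ℝ), ∀ x, HasFDerivAt (fun y => u (s, y))
      ((fderiv ℝ u (s, x)).comp
        (ContinuousLinearMap.inr ℝ ℝ (EuclideanSpace ℝ (Fin d)))) x := fun s hs x =>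
    (hdu s hs x).comp x (hasFDerivAt_prodMk_right s x)
  have htime : ∀ s > (0:ℝ), ∀ x, deriv (fun r => u (r, x)) s = fderiv ℝ u (s, x) (1, 0) := by
    intro s hs x
    have h := ((hdu s hs x).comp s (hasFDerivAt_prodMk_left s x)).hasDerivAt
    have h2 := h.deriv
    simpa [Function.comp_def] using h2
  have hgrad : ∀ s > (0:ℝ), ∀ x, gradient (fun y => u (s, y)) x =
      (InnerProductSpace.toDual ℝ (EuclideanSpace ℝ (Fin d))).symm
        ((fderiv ℝ u (s, x)).comp
          (ContinuousLinearMap.inr ℝ ℝ (EuclideanSpace ℝ (Fin d)))) := by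
    intro s hs x
    rw [gradient, (hspace s hs x).fderiv]
  have hzero : ∀ s > (0:ℝ), (fderiv ℝ u (s, xbar s)).comp
      (ContinuousLinearMap.inr ℝ ℝ (EuclideanSpace ℝ (Fin d))) = 0 := by
    intro s hs
    have hm : IsLocalMax (fun y => u (s, y)) (xbar s) :=
      Filter.Eventually.of_forall (hmax s hs)
    exact hm.hasFDerivAt_eq_zero (hspace s hs _)
  -- second derivative
  obtain ⟨B, hB⟩ : ∃ B, B = fderiv ℝ (fderiv ℝ u) (t, xbar t) := ⟨_, rfl⟩
  have hBd : HasFDerivAt (fderiv ℝ u) B (t, xbar t) := by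
    rw [hB]
    exact (((hC t ht (xbar t)).fderiv_right (m := 1) (by norm_num)).differentiableAt
      (by norm_num)).hasFDerivAt
  have hsymm : ∀ v w, B v w = B w v := by
    intro v w
    have h := (hC t ht (xbar t)).isSymmSndFDerivAt (by simp)
    rw [hB]
    exact h v w
  have hBx : HasFDerivAt (fun y => fderiv ℝ u (t, y))
      (B.comp (ContinuousLinearMap.inr ℝ ℝ (EuclideanSpace ℝ (Fin d)))) (xbar t) :=
    hBd.comp (xbar t) (hasFDerivAt_prodMk_right t (xbar t))
  -- the gradient map is differentiable
  have hgd : HasFDerivAt (gradient (fun y => u (t, y)))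
      (hessAt (fun y => u (t, y)) (xbar t)) (xbar t) := by
    have hfun : gradient (fun y => u (t, y)) = fun x =>
      (InnerProductSpace.toDual ℝ (EuclideanSpace ℝ (Fin d))).symm
        ((fderiv ℝ u (t, x)).comp
          (ContinuousLinearMap.inr ℝ ℝ (EuclideanSpace ℝ (Fin d)))) := funext (hgrad t ht)
    have hd1 : DifferentiableAt ℝ (gradient (fun y => u (t, y))) (xbar t) := by
      rw [hfun]
      have h1 : DifferentiableAt ℝ (fun x => (fderiv ℝ u (t, x)).comp
          (ContinuousLinearMap.inr ℝ ℝ (EuclideanSpace ℝ (Fin d)))) (xbar t) :=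
        hBx.differentiableAt.clm_comp (differentiableAt_const _)
      exact ((InnerProductSpace.toDual ℝ
        (EuclideanSpace ℝ (Fin d))).symm.toContinuousLinearEquiv.differentiableAt).comp
          (xbar t) h1
    exact hd1.hasFDerivAt
  have hg0 : gradient (fun y => u (t, y)) (xbar t) = 0 := by
    rw [hgrad t ht, hzero t ht, map_zero]
  have hinner : ∀ x w, inner ℝ (gradient (fun y => u (t, y)) x) w
      = fderiv ℝ u (t, x) (0, w) := by
    intro x w
    rw [hgrad t ht, InnerProductSpace.toDual_symm_apply]
    simp
  have hhess : ∀ v w, inner ℝ (hessAt (fun y => u (t, y)) (xbar t) v) w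
      = B (0, v) (0, w) := by
    intro v w
    have h1 := hgd.inner ℝ (hasFDerivAt_const w (xbar t))
    have h2 := hBx.clm_apply (hasFDerivAt_const ((0:ℝ), w) (xbar t))
    simp only [hinner] at h1
    have h3 := DFunLike.congr_fun (h1.unique h2) v
    simpa using h3
  -- differentiate the optimality condition in time
  have hopt : ∀ w, B (1, deriv xbar t) (0, w) = 0 := by
    intro w
    have h1 : HasDerivAt (fun s => (s, xbar s)) ((1:ℝ), deriv xbar t) t :=
      (hasDerivAt_id t).prodMk (hxbar t ht).hasDerivAt
    have h2 : HasDerivAt (fun s => fderiv ℝ u (s, xbar s)) (B (1, deriv xbar t)) t :=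
      HasFDerivAt.comp_hasDerivAt (x := t) (f := fun s => (s, xbar s)) hBd h1
    have h3 := h2.clm_apply (hasDerivAt_const t ((0:ℝ), w))
    have h4 : (fun s => fderiv ℝ u (s, xbar s) ((0:ℝ), w)) =ᶠ[nhds t] fun _ => (0:ℝ) := by
      filter_upwards [Ioi_mem_nhds ht] with s hs
      have := DFunLike.congr_fun (hzero s hs) w
      simpa using this
    have h5 := (h3.congr_of_eventuallyEq h4.symm).unique (hasDerivAt_const t (0:ℝ))
    simpa using h5
  -- differentiate the equation in space
  have hRd : HasFDerivAt (fun y => R (y, I t)) (fderiv ℝ (fun y => R (y, I t)) (xbar t))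
      (xbar t) := (((hR (I t)).differentiable (by norm_num)) _).hasFDerivAt
  have hspc : ∀ w, B (0, w) (1, 0) = fderiv ℝ (fun y => R (y, I t)) (xbar t) w := by
    intro w
    have h1 := hBx.clm_apply
      (hasFDerivAt_const ((1:ℝ), (0 : EuclideanSpace ℝ (Fin d))) (xbar t))
    have h2 := hRd.add hgd.norm_sq
    have h3 : (fun y => fderiv ℝ u (t, y) ((1:ℝ), (0 : EuclideanSpace ℝ (Fin d)))) =
        (fun y => R (y, I t)) + fun y => ‖gradient (fun y => u (t, y)) y‖ ^ 2 := by
      funext y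
      rw [← htime t ht y, heq t ht y]
      rfl
    rw [h3] at h1
    have h4 := DFunLike.congr_fun (h1.unique h2) w
    simpa [hg0] using h4
  have hmain : (-(hessAt (fun y => u (t, y)) (xbar t))) (deriv xbar t)
      = gradient (fun y => R (y, I t)) (xbar t) := by
    refine ext_inner_right ℝ fun w => ?_
    have h1 : inner ℝ (gradient (fun y => R (y, I t)) (xbar t)) w
        = fderiv ℝ (fun y => R (y, I t)) (xbar t) w := by
      rw [gradient, InnerProductSpace.toDual_symm_apply]
    have h2 : B (1, deriv xbar t) (0, w) = B (1, 0) (0, w) + B (0, deriv xbar t) (0, w) := by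
      rw [← ContinuousLinearMap.add_apply, ← map_add]
      simp
    rw [h1, ContinuousLinearMap.neg_apply, inner_neg_left, hhess, ← hspc w, hsymm (0, w)]
    have := hopt w
    linarith
  rw [← hmain, ← ContinuousLinearMap.mul_apply, Ring.inverse_mul_cancel _ (hinv t ht).neg,
    ContinuousLinearMap.one_apply]
end

section
/- Let d ≥ 1 and let R : ℝ^d × ℝ → ℝ be continuously differentiable with ∂R/∂I(x,I) < 0 for all (x,I). Let x̄ : [0,∞) → ℝ^d and Ī : [0,∞) → ℝ be continuously differentiable, suppose R(x̄(t), Ī(t)) = 0 for all t ≥ 0, and suppose x̄'(t) = A(t)·∇ₓR(x̄(t), Ī(t)) where, for each t, A(t) is a symmetric positive semidefinite d×d real matrix. Then for all t ≥ 0, Ī'(t) = (−1/(∂R/∂I)(x̄(t),Ī(t))) · ⟨∇ₓR(x̄(t),Ī(t)), A(t)·∇ₓR(x̄(t),Ī(t))⟩ ≥ 0; in particular Ī is nondecreasing. -/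
open scoped RealInnerProductSpace

/-- Let `R` be `C¹` with `∂R/∂I < 0` everywhere. If `x̄`, `Ī` are `C¹`,
satisfy the constraint `R(x̄(t), Ī(t)) = 0` for `t ≥ 0` and the canonical equation
`x̄'(t) = A(t)·∇ₓR(x̄(t), Ī(t))` with `A(t)` symmetric positive semidefinite, then
`Ī'(t) = (−1/(∂R/∂I)) ⟨∇ₓR, A(t)∇ₓR⟩ ≥ 0` for all `t ≥ 0`; in particular `Ī` is
nondecreasing on `[0,∞)`. -/
theorem gradient_flow_structure (d : ℕ) (hd : 1 ≤ d)
    (R : EuclideanSpace ℝ (Fin d) × ℝ → ℝ) (hR : ContDiff ℝ 1 R)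
    (hRI : ∀ (x : EuclideanSpace ℝ (Fin d)) (I : ℝ), deriv (fun J => R (x, J)) I < 0)
    (xbar : ℝ → EuclideanSpace ℝ (Fin d)) (Ibar : ℝ → ℝ)
    (hxbar : ContDiff ℝ 1 xbar) (hIbar : ContDiff ℝ 1 Ibar)
    (hcon : ∀ t ≥ (0:ℝ), R (xbar t, Ibar t) = 0)
    (A : ℝ → Matrix (Fin d) (Fin d) ℝ)
    (hA : ∀ t ≥ (0:ℝ), (A t).PosSemidef)
    (hcano : ∀ t ≥ (0:ℝ), deriv xbar t =
      Matrix.toEuclideanLin (A t) (gradient (fun y => R (y, Ibar t)) (xbar t))) :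
    (∀ t ≥ (0:ℝ),
      deriv Ibar t = (-1 / deriv (fun J => R (xbar t, J)) (Ibar t)) *
        ⟪gradient (fun y => R (y, Ibar t)) (xbar t),
          Matrix.toEuclideanLin (A t) (gradient (fun y => R (y, Ibar t)) (xbar t))⟫ ∧
      0 ≤ deriv Ibar t) ∧
    MonotoneOn Ibar (Set.Ici 0) := by
  have key : ∀ t ≥ (0:ℝ),
      deriv Ibar t = (-1 / deriv (fun J => R (xbar t, J)) (Ibar t)) *
        ⟪gradient (fun y => R (y, Ibar t)) (xbar t),
          Matrix.toEuclideanLin (A t) (gradient (fun y => R (y, Ibar t)) (xbar t))⟫ ∧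
      0 ≤ deriv Ibar t := by
    intro t ht
    have hRd : HasFDerivAt R (fderiv ℝ R (xbar t, Ibar t)) (xbar t, Ibar t) :=
      (hR.differentiable one_ne_zero _).hasFDerivAt
    set L := fderiv ℝ R (xbar t, Ibar t) with hL
    have hx : HasDerivAt xbar (deriv xbar t) t :=
      (hxbar.differentiable one_ne_zero t).hasDerivAt
    have hI : HasDerivAt Ibar (deriv Ibar t) t :=
      (hIbar.differentiable one_ne_zero t).hasDerivAt
    have h1 : HasDerivAt (fun s => R (xbar s, Ibar s)) (L (deriv xbar t, deriv Ibar t)) t :=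
      HasFDerivAt.comp_hasDerivAt (f := fun s => (xbar s, Ibar s)) t hRd (hx.prodMk hI)
    have h2 : HasDerivWithinAt (fun s => R (xbar s, Ibar s)) 0 (Set.Ici 0) t :=
      (hasDerivWithinAt_const t (Set.Ici (0:ℝ)) (0:ℝ)).congr (fun s hs => hcon s hs) (hcon t ht)
    have h0 : L (deriv xbar t, deriv Ibar t) = 0 :=
      (uniqueDiffOn_Ici (0:ℝ) t ht).eq_deriv _ h1.hasDerivWithinAt h2
    have hJ : HasDerivAt (fun J => R (xbar t, J)) (L (0, 1)) (Ibar t) :=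
      HasFDerivAt.comp_hasDerivAt (f := fun J : ℝ => (xbar t, J)) (Ibar t) hRd
        ((hasDerivAt_const _ _).prodMk (hasDerivAt_id _))
    have hG : HasFDerivAt (fun y => R (y, Ibar t))
        (L.comp (ContinuousLinearMap.inl ℝ _ ℝ)) (xbar t) :=
      HasFDerivAt.comp (f := fun y => (y, Ibar t)) (xbar t) hRd (hasFDerivAt_prodMk_left _ _)
    have hin : ∀ v, ⟪gradient (fun y => R (y, Ibar t)) (xbar t), v⟫ = L (v, 0) := by
      intro v
      rw [gradient, hG.fderiv, InnerProductSpace.toDual_symm_apply]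
      simp
    have hneg := hRI (xbar t) (Ibar t)
    have hsplit : L (deriv xbar t, deriv Ibar t)
        = L (deriv xbar t, 0) + deriv Ibar t * L (0, 1) := by
      rw [← smul_eq_mul, ← map_smul, ← map_add]
      simp
    have hpos : 0 ≤ ⟪gradient (fun y => R (y, Ibar t)) (xbar t),
          Matrix.toEuclideanLin (A t) (gradient (fun y => R (y, Ibar t)) (xbar t))⟫ := by
      have := (Matrix.isPositive_toEuclideanLin_iff.2 (hA t ht)).re_inner_nonneg_right
        (gradient (fun y => R (y, Ibar t)) (xbar t))
      simpa using this
    have heq : deriv Ibar t = (-1 / deriv (fun J => R (xbar t, J)) (Ibar t)) *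
        ⟪gradient (fun y => R (y, Ibar t)) (xbar t),
          Matrix.toEuclideanLin (A t) (gradient (fun y => R (y, Ibar t)) (xbar t))⟫ := by
      rw [← hcano t ht, hin, hJ.deriv]
      rw [hJ.deriv] at hneg
      have := hneg.ne
      field_simp
      linarith
    refine ⟨heq, ?_⟩
    rw [heq]
    exact mul_nonneg (div_nonneg_of_nonpos (by norm_num) hneg.le) hpos
  refine ⟨key, ?_⟩
  refine monotoneOn_of_deriv_nonneg (convex_Ici 0) hIbar.continuous.continuousOn
    (hIbar.differentiable one_ne_zero).differentiableOn ?_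
  intro t ht
  exact (key t (interior_subset ht)).2
end

section
/- Let d ≥ 1, I_M > 0, and positive constants K̄₀, K̄₁, K̲₁, K̄₂, K̲₂, L̄₁, L̲₁ with L̄₁ ≤ L̲₁. Let R : ℝ^d × [0, I_M] → ℝ be twice continuously differentiable and satisfy: (i) max_{x ∈ ℝ^d} R(x, I_M) = 0 = R(0, I_M); (ii) −K̲₁|x|² ≤ R(x,I) ≤ K̄₀ − K̄₁|x|² for all x and all I ∈ [0, I_M]; (iii) −2K̲₁·Id ≤ D²ₓR(x,I) ≤ −2K̄₁·Id as symmetric matrices for all x and I ∈ [0, I_M]; (iv) −K̲₂ ≤ ∂R/∂I(x,I) ≤ −K̄₂ < 0 for all x and I ∈ [0, I_M]. Let x̄ : [0,∞) → ℝ^d and Ī : [0,∞) → [I_m, I_M] (for some I_m > 0) be continuously differentiable with R(x̄(t), Ī(t)) = 0 for all t ≥ 0, and suppose x̄'(t) = A(t)·∇ₓR(x̄(t), Ī(t)) where each A(t) is a symmetric d×d matrix satisfying (1/(2L̲₁))·Id ≤ A(t) ≤ (1/(2L̄₁))·Id as symmetric matrices. Then Ī is nondecreasing, Ī(t) → I_M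 as t → ∞, and x̄(t) → 0 as t → ∞. -/
open scoped RealInnerProductSpace

/-- Strong concavity from the Hessian bound. -/
theorem strong_concave {d : ℕ} (f : EuclideanSpace ℝ (Fin d) → ℝ) (hf : ContDiff ℝ 2 f) (K : ℝ)
    (hH : ∀ x v, ⟪v, hessAt f x v⟫ ≤ -2 * K * ‖v‖ ^ 2) (x v : EuclideanSpace ℝ (Fin d)) :
    f (x + v) ≤ f x + ⟪gradient f x, v⟫ - K * ‖v‖ ^ 2 := by
  have hfd : Differentiable ℝ f := hf.differentiable (by norm_num)
  have hg : ContDiff ℝ 1 (gradient f) := by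
    have h1 : ContDiff ℝ 1 (fderiv ℝ f) := hf.fderiv_right (by norm_num)
    exact ((InnerProductSpace.toDual ℝ (EuclideanSpace ℝ (Fin d))).symm.contDiff).comp h1
  have hgd : Differentiable ℝ (gradient f) := hg.differentiable (by norm_num)
  have hline : ∀ s : ℝ, HasDerivAt (fun s : ℝ => x + s • v) v s := fun s => by
    simpa using ((hasDerivAt_id s).smul_const v).const_add x
  have h1 : ∀ s : ℝ, HasDerivAt (fun s : ℝ => f (x + s • v)) ⟪gradient f (x + s • v), v⟫ s := by
    intro s
    have := ((hfd (x + s • v)).hasFDerivAt).comp_hasDerivAt s (hline s)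
    rw [← inner_gradient_left (f := f)] at this
    exact this
  have h2 : ∀ s : ℝ, HasDerivAt (fun s : ℝ => ⟪gradient f (x + s • v), v⟫)
      ⟪hessAt f (x + s • v) v, v⟫ s := by
    intro s
    have h := ((hgd (x + s • v)).hasFDerivAt).comp_hasDerivAt s (hline s)
    have := h.inner ℝ (hasDerivAt_const s v)
    simpa [hessAt, Function.comp_def] using this
  have h3 : ∀ s : ℝ, HasDerivAt
      (fun s : ℝ => ⟪gradient f (x + s • v), v⟫ + 2 * K * ‖v‖ ^ 2 * s - ⟪gradient f x, v⟫)
      (⟪hessAt f (x + s • v) v, v⟫ + 2 * K * ‖v‖ ^ 2) s := by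
    intro s
    simpa using ((h2 s).add ((hasDerivAt_id s).const_mul (2 * K * ‖v‖ ^ 2))).sub_const
      ⟪gradient f x, v⟫
  have h3a := antitone_of_hasDerivAt_nonpos h3 (fun s => by
    have := hH (x + s • v) v
    rw [real_inner_comm] at this
    show _ ≤ (0:ℝ)
    linarith)
  have h4 : ∀ s : ℝ, HasDerivAt
      (fun s : ℝ => f (x + s • v) + K * ‖v‖ ^ 2 * s ^ 2 - s * ⟪gradient f x, v⟫)
      (⟪gradient f (x + s • v), v⟫ + 2 * K * ‖v‖ ^ 2 * s - ⟪gradient f x, v⟫) s := by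
    intro s
    have := ((h1 s).add ((hasDerivAt_pow 2 s).const_mul (K * ‖v‖ ^ 2))).sub
      ((hasDerivAt_id s).mul_const ⟪gradient f x, v⟫)
    refine HasDerivAt.congr_deriv this ?_
    push_cast
    ring
  have h5 : AntitoneOn
      (fun s : ℝ => f (x + s • v) + K * ‖v‖ ^ 2 * s ^ 2 - s * ⟪gradient f x, v⟫)
      (Set.Icc 0 1) := by
    apply antitoneOn_of_deriv_nonpos (convex_Icc 0 1)
    · exact fun s _ => (h4 s).continuousAt.continuousWithinAt
    · exact fun s _ => (h4 s).differentiableAt.differentiableWithinAt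
    · intro s hs
      rw [interior_Icc] at hs
      rw [(h4 s).deriv]
      have := h3a hs.1.le
      simp [-inner_gradient_left] at this
      linarith
  have := h5 (Set.left_mem_Icc.2 zero_le_one) (Set.right_mem_Icc.2 zero_le_one) zero_le_one
  simp [-inner_gradient_left] at this
  linarith

/-- Mean value bounds in the variable `I`. -/
theorem mvt_I {d : ℕ} (R : EuclideanSpace ℝ (Fin d) × ℝ → ℝ) (hR : ContDiff ℝ 2 R)
    (IM K2 K2' : ℝ)
    (hRI : ∀ x, ∀ I ∈ Set.Icc (0:ℝ) IM,
      -K2' ≤ deriv (fun J => R (x, J)) I ∧ deriv (fun J => R (x, J)) I ≤ -K2)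
    (x : EuclideanSpace ℝ (Fin d)) (I : ℝ) (hI : I ∈ Set.Icc (0:ℝ) IM) :
    -K2' * (IM - I) ≤ R (x, IM) - R (x, I) ∧ R (x, IM) - R (x, I) ≤ -K2 * (IM - I) := by
  have hd : Differentiable ℝ (fun J => R (x, J)) :=
    (hR.differentiable (by norm_num)).comp (by fun_prop)
  have hIM : IM ∈ Set.Icc (0:ℝ) IM := ⟨hI.1.trans hI.2, le_rfl⟩
  constructor
  · apply (convex_Icc (0:ℝ) IM).mul_sub_le_image_sub_of_le_deriv hd.continuous.continuousOn
      hd.differentiableOn _ I hI IM hIM hI.2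
    exact fun t ht => (hRI x t (interior_subset ht)).1
  · apply (convex_Icc (0:ℝ) IM).image_sub_le_mul_sub_of_deriv_le hd.continuous.continuousOn
      hd.differentiableOn _ I hI IM hIM hI.2
    exact fun t ht => (hRI x t (interior_subset ht)).2

theorem inner_low {d : ℕ} (A : Matrix (Fin d) (Fin d) ℝ) (c : ℝ)
    (hA : (A - c • (1 : Matrix (Fin d) (Fin d) ℝ)).PosSemidef) (g : EuclideanSpace ℝ (Fin d)) :
    c * ‖g‖ ^ 2 ≤ ⟪g, Matrix.toEuclideanLin A g⟫ := by
  have h := hA.dotProduct_mulVec_nonneg (WithLp.ofLp g)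
  rw [Matrix.sub_mulVec, dotProduct_sub, Matrix.smul_mulVec, Matrix.one_mulVec,
    dotProduct_smul] at h
  have e1 : ⟪g, Matrix.toEuclideanLin A g⟫ = star (WithLp.ofLp g) ⬝ᵥ A.mulVec (WithLp.ofLp g) := by
    rw [EuclideanSpace.inner_eq_star_dotProduct, dotProduct_comm]
    simp
  have e2 : ‖g‖ ^ 2 = star (WithLp.ofLp g) ⬝ᵥ WithLp.ofLp g := by
    rw [← real_inner_self_eq_norm_sq, EuclideanSpace.inner_eq_star_dotProduct, dotProduct_comm]
  rw [e1, e2]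
  simp only [smul_eq_mul] at h
  linarith

/-- Long-time behaviour of the canonical-equation dynamics.
Here `K0 = K̄₀`, `K1 = K̄₁`, `K1' = K̲₁`, `K2 = K̄₂`, `K2' = K̲₂`, `L1 = L̄₁`, `L1' = L̲₁`.
Under the fitness assumptions (i)–(iv) on `R`, the constraint `R(x̄(t), Ī(t)) = 0` and
the canonical equation `x̄'(t) = A(t)·∇ₓR(x̄(t), Ī(t))` with symmetric matrices
`(1/(2L̲₁))·Id ≤ A(t) ≤ (1/(2L̄₁))·Id`, the nonlocal term `Ī` is nondecreasing,
`Ī(t) → I_M` and `x̄(t) → 0` as `t → ∞`. -/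
theorem long_time_behaviour (d : ℕ) (hd : 1 ≤ d) (IM : ℝ) (hIM : 0 < IM)
    (K0 K1 K1' K2 K2' L1 L1' : ℝ)
    (hK0 : 0 < K0) (hK1 : 0 < K1) (hK1' : 0 < K1') (hK2 : 0 < K2) (hK2' : 0 < K2')
    (hL1 : 0 < L1) (hL1' : 0 < L1') (hLL : L1 ≤ L1')
    (R : EuclideanSpace ℝ (Fin d) × ℝ → ℝ) (hR : ContDiff ℝ 2 R)
    (hRmax : (∀ x, R (x, IM) ≤ 0) ∧ R (0, IM) = 0)
    (hRbound : ∀ x, ∀ I ∈ Set.Icc (0:ℝ) IM,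
      -K1' * ‖x‖ ^ 2 ≤ R (x, I) ∧ R (x, I) ≤ K0 - K1 * ‖x‖ ^ 2)
    (hRhess : ∀ x, ∀ I ∈ Set.Icc (0:ℝ) IM, ∀ v,
      -2 * K1' * ‖v‖ ^ 2 ≤ ⟪v, hessAt (fun y => R (y, I)) x v⟫ ∧
      ⟪v, hessAt (fun y => R (y, I)) x v⟫ ≤ -2 * K1 * ‖v‖ ^ 2)
    (hRI : ∀ x, ∀ I ∈ Set.Icc (0:ℝ) IM,
      -K2' ≤ deriv (fun J => R (x, J)) I ∧ deriv (fun J => R (x, J)) I ≤ -K2)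
    (Im : ℝ) (hIm : 0 < Im)
    (xbar : ℝ → EuclideanSpace ℝ (Fin d)) (Ibar : ℝ → ℝ)
    (hxbar : ContDiff ℝ 1 xbar) (hIbar : ContDiff ℝ 1 Ibar)
    (hrange : ∀ t ≥ (0:ℝ), Ibar t ∈ Set.Icc Im IM)
    (hcon : ∀ t ≥ (0:ℝ), R (xbar t, Ibar t) = 0)
    (A : ℝ → Matrix (Fin d) (Fin d) ℝ)
    (hAsymm : ∀ t ≥ (0:ℝ), (A t).IsSymm)
    (hAlow : ∀ t ≥ (0:ℝ), (A t - (1 / (2 * L1')) • (1 : Matrix (Fin d) (Fin d) ℝ)).PosSemidef)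
    (hAup : ∀ t ≥ (0:ℝ), ((1 / (2 * L1)) • (1 : Matrix (Fin d) (Fin d) ℝ) - A t).PosSemidef)
    (hcano : ∀ t ≥ (0:ℝ), deriv xbar t =
      Matrix.toEuclideanLin (A t) (gradient (fun y => R (y, Ibar t)) (xbar t))) :
    MonotoneOn Ibar (Set.Ici 0) ∧
    Filter.Tendsto Ibar Filter.atTop (nhds IM) ∧
    Filter.Tendsto xbar Filter.atTop (nhds 0) := by
  have hRd : Differentiable ℝ R := hR.differentiable (by norm_num)
  have hId : Differentiable ℝ Ibar := hIbar.differentiable (by norm_num)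
  have hxd : Differentiable ℝ xbar := hxbar.differentiable (by norm_num)
  have hrange' : ∀ t ≥ (0:ℝ), Ibar t ∈ Set.Icc (0:ℝ) IM := fun t ht =>
    ⟨hIm.le.trans (hrange t ht).1, (hrange t ht).2⟩
  have hslice : ∀ I, ContDiff ℝ 2 (fun y => R (y, I)) := fun I => hR.comp (by fun_prop)
  have hconc : ∀ I ∈ Set.Icc (0:ℝ) IM, ∀ x v, R (x + v, I) ≤
      R (x, I) + ⟪gradient (fun y => R (y, I)) x, v⟫ - K1 * ‖v‖ ^ 2 := fun I hI x v =>
    strong_concave (fun y => R (y, I)) (hslice I) K1 (fun x v => (hRhess x I hI v).2) x v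
  -- the differentiated constraint
  have hder : ∀ t > (0:ℝ), ⟪gradient (fun y => R (y, Ibar t)) (xbar t), deriv xbar t⟫ +
      deriv (fun J => R (xbar t, J)) (Ibar t) * deriv Ibar t = 0 := by
    intro t ht
    have hF := (hRd (xbar t, Ibar t)).hasFDerivAt
    have h1 : HasDerivAt (fun s => R (xbar s, Ibar s))
        (fderiv ℝ R (xbar t, Ibar t) (deriv xbar t, deriv Ibar t)) t :=
      hF.comp_hasDerivAt t ((hxd t).hasDerivAt.prodMk (hId t).hasDerivAt)
    have h2 : HasDerivAt (fun s => R (xbar s, Ibar s)) 0 t := by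
      apply (hasDerivAt_const t (0:ℝ)).congr_of_eventuallyEq
      filter_upwards [lt_mem_nhds ht] with s hs using hcon s hs.le
    have h3 := h1.unique h2
    have h4 : HasFDerivAt (fun y => R (y, Ibar t))
        ((fderiv ℝ R (xbar t, Ibar t)).comp (ContinuousLinearMap.inl ℝ _ ℝ)) (xbar t) :=
      hF.comp (xbar t) (hasFDerivAt_prodMk_left (xbar t) (Ibar t))
    have h5 : HasDerivAt (fun J => R (xbar t, J))
        (fderiv ℝ R (xbar t, Ibar t) (0, 1)) (Ibar t) :=
      hF.comp_hasDerivAt (Ibar t) ((hasDerivAt_const _ _).prodMk (hasDerivAt_id _))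
    rw [inner_gradient_left, h4.fderiv, h5.deriv, ← h3]
    have : ((deriv xbar t, deriv Ibar t) : EuclideanSpace ℝ (Fin d) × ℝ)
        = (deriv xbar t, 0) + deriv Ibar t • (0, 1) := by simp
    rw [this, map_add, map_smul]
    simp [mul_comm]
  have hkey : ∀ t > (0:ℝ), 0 ≤ deriv Ibar t ∧
      1 / (2 * L1') * ‖gradient (fun y => R (y, Ibar t)) (xbar t)‖ ^ 2 ≤ K2' * deriv Ibar t := by
    intro t ht
    have h1 := hder t ht
    rw [hcano t ht.le] at h1
    have h2 := inner_low (A t) _ (hAlow t ht.le) (gradient (fun y => R (y, Ibar t)) (xbar t))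
    obtain ⟨h3, h4⟩ := hRI (xbar t) (Ibar t) (hrange' t ht.le)
    have h5 : 0 ≤ 1 / (2 * L1') * ‖gradient (fun y => R (y, Ibar t)) (xbar t)‖ ^ 2 := by
      positivity
    have h6 : 0 ≤ deriv Ibar t := by
      by_contra hneg
      push Not at hneg
      nlinarith
    exact ⟨h6, by nlinarith⟩
  have hgrad : ∀ t ≥ (0:ℝ), 4 * K1 * K2 * (IM - Ibar t) ≤
      ‖gradient (fun y => R (y, Ibar t)) (xbar t)‖ ^ 2 := by
    intro t ht
    have h1 := hconc (Ibar t) (hrange' t ht) (xbar t) (-xbar t)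
    have h2 := (mvt_I R hR IM K2 K2' hRI 0 (Ibar t) (hrange' t ht)).2
    rw [hRmax.2] at h2
    rw [add_neg_cancel, hcon t ht, norm_neg] at h1
    have h3 := real_inner_le_norm (gradient (fun y => R (y, Ibar t)) (xbar t)) (-xbar t)
    rw [norm_neg] at h3
    set G := ‖gradient (fun y => R (y, Ibar t)) (xbar t)‖
    have h4 : K2 * (IM - Ibar t) ≤ G * ‖xbar t‖ - K1 * ‖xbar t‖ ^ 2 := by linarith
    nlinarith [sq_nonneg (G - 2 * K1 * ‖xbar t‖), mul_le_mul_of_nonneg_left h4 hK1.le]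
  set c : ℝ := 4 * K1 * K2 / (2 * L1' * K2') with hc
  have hcpos : 0 < c := by positivity
  have hode : ∀ t > (0:ℝ), c * (IM - Ibar t) ≤ deriv Ibar t := by
    intro t ht
    have h1 := (hkey t ht).2
    have h2 := hgrad t ht.le
    rw [hc, div_mul_eq_mul_div, div_le_iff₀ (by positivity)]
    rw [div_mul_eq_mul_div, div_le_iff₀ (by positivity)] at h1
    linarith
  have hmono : MonotoneOn Ibar (Set.Ici 0) := by
    apply monotoneOn_of_deriv_nonneg (convex_Ici 0) hId.continuous.continuousOn
      hId.differentiableOn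
    intro t ht
    rw [interior_Ici] at ht
    exact (hkey t ht).1
  have hanti : AntitoneOn (fun t => (IM - Ibar t) * Real.exp (c * t)) (Set.Ici 0) := by
    have hD : ∀ t, HasDerivAt (fun t => (IM - Ibar t) * Real.exp (c * t))
        (-deriv Ibar t * Real.exp (c * t) + (IM - Ibar t) * (Real.exp (c * t) * c)) t := by
      intro t
      have := ((hId t).hasDerivAt.const_sub IM).mul
        (((hasDerivAt_id t).const_mul c).exp)
      refine HasDerivAt.congr_deriv this ?_
      simp
    apply antitoneOn_of_deriv_nonpos (convex_Ici 0)
    · exact fun t _ => (hD t).continuousAt.continuousWithinAt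
    · exact fun t _ => (hD t).differentiableAt.differentiableWithinAt
    · intro t ht
      rw [interior_Ici] at ht
      rw [(hD t).deriv]
      nlinarith [hode t ht, Real.exp_pos (c * t)]
  have hbd : ∀ t ≥ (0:ℝ), IM - Ibar t ≤ (IM - Ibar 0) * Real.exp (-(c * t)) := by
    intro t ht
    have h := hanti (Set.mem_Ici.2 le_rfl) (Set.mem_Ici.2 ht) ht
    simp only [mul_zero, Real.exp_zero, mul_one] at h
    rw [Real.exp_neg, ← div_eq_mul_inv, le_div_iff₀ (Real.exp_pos _)]
    exact h
  have hexp : Filter.Tendsto (fun t => (IM - Ibar 0) * Real.exp (-(c * t))) Filter.atTop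
      (nhds 0) := by
    have := (Real.tendsto_exp_neg_atTop_nhds_zero.comp
      (Filter.tendsto_id.const_mul_atTop hcpos)).const_mul (IM - Ibar 0)
    simpa [Function.comp_def] using this
  have hdiff : Filter.Tendsto (fun t => IM - Ibar t) Filter.atTop (nhds 0) := by
    apply tendsto_of_tendsto_of_tendsto_of_le_of_le' tendsto_const_nhds hexp
    · filter_upwards [Filter.eventually_ge_atTop (0:ℝ)] with t ht
      linarith [(hrange t ht).2]
    · filter_upwards [Filter.eventually_ge_atTop (0:ℝ)] with t ht using hbd t ht
  refine ⟨hmono, ?_, ?_⟩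
  · simpa using (tendsto_const_nhds (x := IM)).sub hdiff
  · have hg0 : gradient (fun y => R (y, IM)) 0 = 0 := by
      have hm : IsLocalMax (fun y => R (y, IM)) 0 :=
        Filter.Eventually.of_forall fun y => by
          show R (y, IM) ≤ R (0, IM)
          rw [hRmax.2]; exact hRmax.1 y
      rw [gradient, hm.fderiv_eq_zero, map_zero]
    have hx : ∀ t ≥ (0:ℝ), ‖xbar t‖ ^ 2 ≤ K2' / K1 * (IM - Ibar t) := by
      intro t ht
      have h1 := hconc IM ⟨hIM.le, le_rfl⟩ 0 (xbar t)
      rw [hg0, hRmax.2, zero_add, inner_zero_left] at h1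
      have h2 := (mvt_I R hR IM K2 K2' hRI (xbar t) (Ibar t) (hrange' t ht)).1
      rw [hcon t ht] at h2
      rw [div_mul_eq_mul_div, le_div_iff₀ hK1]
      linarith
    have hsq : Filter.Tendsto (fun t => ‖xbar t‖ ^ 2) Filter.atTop (nhds 0) := by
      apply tendsto_of_tendsto_of_tendsto_of_le_of_le' tendsto_const_nhds
        (by simpa using hdiff.const_mul (K2' / K1))
      · exact Filter.Eventually.of_forall fun t => by positivity
      · filter_upwards [Filter.eventually_ge_atTop (0:ℝ)] with t ht using hx t ht
    rw [tendsto_zero_iff_norm_tendsto_zero]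
    simpa [Real.sqrt_sq] using hsq.sqrt
end

section
/- Let d ≥ 1, T > 0, ε > 0, I_M > 0, and positive constants K̄₀, K̄₁, K̲₁, L̄₀, L̲₀, L̄₁, L̲₁ with 4L̄₁² ≤ K̄₁ and K̲₁ ≤ 4L̲₁². Let R : ℝ^d × ℝ → ℝ be continuous with −K̲₁|x|² ≤ R(x,I) ≤ K̄₀ − K̄₁|x|² for all x ∈ ℝ^d and all I ∈ [0, I_M], and let I : [0,T] → [0, I_M] be continuous. Let u_ε : [0,T] × ℝ^d → ℝ be continuously differentiable in t and twice continuously differentiable in x, with sup_{[0,T]×ℝ^d} ‖D²ₓu_ε‖ < ∞, satisfying ∂ₜu_ε = |∇ₓu_ε|² + R(x, I(t)) + εΔu_ε on (0,T] × ℝ^d and −L̲₀ − L̲₁|x|² ≤ u_ε(0,x) ≤ L̄₀ − L̄₁|x|² for all x. Then for all (t,x) ∈ [0,T] × ℝ^d: −L̲₀ − L̲₁|x|² − 2dεL̲₁t ≤ u_ε(t,x) ≤ L̄₀ − L̄₁|x|² + (K̄₀ + 2dεL̄₁)t. -/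
/-- The Laplacian of `f` at `x`: the trace of the Hessian. -/
noncomputable def lapAt {d : ℕ} (f : EuclideanSpace ℝ (Fin d) → ℝ)
    (x : EuclideanSpace ℝ (Fin d)) : ℝ :=
  LinearMap.trace ℝ (EuclideanSpace ℝ (Fin d)) (hessAt f x).toLinearMap

lemma second_deriv_test {f f' : ℝ → ℝ} {c : ℝ} (hf : ∀ s, HasDerivAt f (f' s) s)
    (hc : HasDerivAt f' c 0) (hmax : ∀ s, f s ≤ f 0) : f' 0 = 0 ∧ c ≤ 0 := by
  have hlm : IsLocalMax f 0 := Filter.Eventually.of_forall hmax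
  have h0 : f' 0 = 0 := hlm.hasDerivAt_eq_zero (hf 0)
  refine ⟨h0, ?_⟩
  by_contra! hpos
  have hd : deriv f = f' := funext fun s => (hf s).deriv
  have hmin : IsLocalMin f 0 := by
    apply isLocalMin_of_deriv_deriv_pos
    · rw [hd, hc.deriv]; exact hpos
    · rw [hd, h0]
    · exact (hf 0).continuousAt
  have hev : f =ᶠ[nhds 0] fun _ => f 0 := by
    filter_upwards [hmin] with s hs
    exact le_antisymm (hmax s) hs
  have h1 : deriv f =ᶠ[nhds 0] deriv (fun _ => f 0) := hev.deriv
  have h2 := h1.deriv_eq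
  rw [hd, hc.deriv] at h2
  simp at h2
  linarith

lemma left_deriv_test {f : ℝ → ℝ} {c t T : ℝ} (ht : 0 < t) (htT : t ≤ T)
    (hf : HasDerivAt f c t) (hmax : ∀ s ∈ Set.Icc 0 T, f s ≤ f t) : 0 ≤ c := by
  have hm : IsLocalMaxOn f (Set.Icc 0 T) t :=
    Filter.eventually_of_mem self_mem_nhdsWithin hmax
  have hcone : (0 - t) ∈ posTangentConeAt (Set.Icc 0 T) t := by
    apply sub_mem_posTangentConeAt_of_segment_subset
    rw [segment_symm, segment_eq_Icc ht.le]
    exact Set.Icc_subset_Icc le_rfl htT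
  have h := hm.hasFDerivWithinAt_nonpos hf.hasFDerivAt.hasFDerivWithinAt hcone
  simp at h
  by_contra! hc
  nlinarith

/-- Quartic barrier along a line. -/
lemma quartic_line {d : ℕ} (x v : EuclideanSpace ℝ (Fin d)) (s : ℝ) :
    (1 + ‖x + s • v‖ ^ 2) ^ 2
      = (1 + ‖x‖ ^ 2 + 2 * s * inner ℝ x v + s ^ 2 * ‖v‖ ^ 2) ^ 2 := by
  rw [norm_add_sq_real, norm_smul, inner_smul_right, mul_pow, Real.norm_eq_abs, sq_abs]
  ring

lemma max_principle {d : ℕ} {T ε C : ℝ} (hε : 0 < ε) (hC : 0 ≤ C)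
    (w : ℝ → EuclideanSpace ℝ (Fin d) → ℝ)
    (G b : ℝ → EuclideanSpace ℝ (Fin d) → EuclideanSpace ℝ (Fin d))
    (H : ℝ → EuclideanSpace ℝ (Fin d) → EuclideanSpace ℝ (Fin d) →L[ℝ] EuclideanSpace ℝ (Fin d))
    (wt : ℝ → EuclideanSpace ℝ (Fin d) → ℝ)
    (hwt : ∀ t x, HasDerivAt (fun s => w s x) (wt t x) t)
    (hG : ∀ t x, HasFDerivAt (w t) (innerSL ℝ (G t x)) x)
    (hH : ∀ t x, HasFDerivAt (G t) (H t x) x)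
    (hcont : ∀ r : ℝ, ContinuousOn (fun p : ℝ × EuclideanSpace ℝ (Fin d) => w p.1 p.2)
      (Set.Icc 0 T ×ˢ Metric.closedBall 0 r))
    (hgrow : ∀ t ∈ Set.Icc 0 T, ∀ x, w t x ≤ C * (1 + ‖x‖ ^ 2))
    (hb : ∀ t ∈ Set.Icc 0 T, ∀ x, ‖b t x‖ ≤ C * (1 + ‖x‖))
    (hpde : ∀ t, 0 < t → t ≤ T → ∀ x, wt t x ≤ inner ℝ (b t x) (G t x) +
      ε * LinearMap.trace ℝ (EuclideanSpace ℝ (Fin d)) (H t x).toLinearMap)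
    (h0 : ∀ x, w 0 x ≤ 0) :
    ∀ t ∈ Set.Icc 0 T, ∀ x, w t x ≤ 0 := by
  intro t0 ht0 x0
  by_contra! hpos
  set lam : ℝ := 8 * C + 12 * d * ε + 1 with hlam
  have hlam0 : 0 < lam := by positivity
  obtain ⟨δ, hδ, hδlt⟩ : ∃ δ : ℝ, 0 < δ ∧
      δ * (Real.exp (lam * t0) * (1 + ‖x0‖ ^ 2) ^ 2) < w t0 x0 := by
    refine ⟨w t0 x0 / 2 / (Real.exp (lam * t0) * (1 + ‖x0‖ ^ 2) ^ 2), by positivity, ?_⟩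
    rw [div_mul_cancel₀ _ (by positivity)]
    linarith
  set ψ : ℝ × EuclideanSpace ℝ (Fin d) → ℝ :=
    fun p => w p.1 p.2 - δ * (Real.exp (lam * p.1) * (1 + ‖p.2‖ ^ 2) ^ 2) with hψ
  set r : ℝ := C / δ + 1 with hr
  have hr1 : 1 ≤ r := by rw [hr]; have : 0 ≤ C / δ := by positivity
                         linarith
  -- outside the ball ψ ≤ 0
  have hout : ∀ t ∈ Set.Icc 0 T, ∀ x, r < ‖x‖ → ψ (t, x) ≤ 0 := by
    intro t ht x hx
    have h1 := hgrow t ht x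
    have hexp : 1 ≤ Real.exp (lam * t) := Real.one_le_exp (mul_nonneg hlam0.le ht.1)
    have h2 : C ≤ δ * (1 + ‖x‖ ^ 2) := by
      have : C / δ ≤ 1 + ‖x‖ ^ 2 := by nlinarith
      rw [div_le_iff₀ hδ] at this
      linarith
    have h3 : C * (1 + ‖x‖ ^ 2) ≤ δ * (1 + ‖x‖ ^ 2) * (1 + ‖x‖ ^ 2) :=
      mul_le_mul_of_nonneg_right h2 (by positivity)
    have h4 : δ * (1 + ‖x‖ ^ 2) ^ 2 * 1 ≤ δ * (1 + ‖x‖ ^ 2) ^ 2 * Real.exp (lam * t) :=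
      mul_le_mul_of_nonneg_left hexp (by positivity)
    simp only [hψ]
    nlinarith
  have hψ0 : 0 < ψ (t0, x0) := by simp only [hψ]; linarith
  have hx0 : ‖x0‖ ≤ r := by
    by_contra! h
    linarith [hout t0 ht0 x0 h]
  have hK : IsCompact (Set.Icc 0 T ×ˢ Metric.closedBall (0 : EuclideanSpace ℝ (Fin d)) r) :=
    isCompact_Icc.prod (isCompact_closedBall 0 r)
  have hψc : ContinuousOn ψ
      (Set.Icc 0 T ×ˢ Metric.closedBall (0 : EuclideanSpace ℝ (Fin d)) r) := by
    apply (hcont r).sub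
    apply Continuous.continuousOn
    fun_prop
  obtain ⟨⟨t1, x1⟩, hmem, hmax⟩ := hK.exists_isMaxOn ⟨(t0, x0), ht0, by simpa using hx0⟩ hψc
  have ht1 : t1 ∈ Set.Icc 0 T := hmem.1
  have hge : ψ (t0, x0) ≤ ψ (t1, x1) := hmax (Set.mk_mem_prod ht0 (by simpa using hx0))
  have hglob : ∀ t ∈ Set.Icc 0 T, ∀ x, ψ (t, x) ≤ ψ (t1, x1) := by
    intro t ht x
    by_cases hx : ‖x‖ ≤ r
    · exact hmax (Set.mk_mem_prod ht (by simpa using hx))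
    · push Not at hx
      linarith [hout t ht x hx]
  have ht1pos : 0 < t1 := by
    rcases ht1.1.eq_or_lt with h | h
    · exfalso
      have h5 := h0 x1
      have h6 : 0 ≤ δ * (Real.exp (lam * t1) * (1 + ‖x1‖ ^ 2) ^ 2) := by positivity
      have h7 : ψ (t1, x1) ≤ 0 := by
        simp only [hψ]
        rw [← h] at h6 ⊢
        linarith
      linarith
    · exact h
  set E : ℝ := Real.exp (lam * t1) with hE
  have hEpos : 0 < E := Real.exp_pos _
  set A : ℝ := 1 + ‖x1‖ ^ 2 with hA
  have hA1 : 1 ≤ A := by rw [hA]; nlinarith [sq_nonneg ‖x1‖]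
  -- time derivative
  have htime : δ * (lam * E * A ^ 2) ≤ wt t1 x1 := by
    have hd : HasDerivAt (fun s => ψ (s, x1)) (wt t1 x1 - δ * (lam * E * A ^ 2)) t1 := by
      have he : HasDerivAt (fun s : ℝ => Real.exp (lam * s)) (E * lam) t1 := by
        have := ((hasDerivAt_id t1).const_mul lam).exp
        simpa using this
      have := (hwt t1 x1).sub ((he.mul_const (A ^ 2)).const_mul δ)
      refine HasDerivAt.congr_deriv this ?_
      ring
    have := left_deriv_test ht1pos ht1.2 hd (fun s hs => hglob s hs x1)
    linarith
  -- space derivatives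
  have hspace : ∀ v : EuclideanSpace ℝ (Fin d),
      inner ℝ (G t1 x1) v = δ * E * (4 * A * inner ℝ x1 v) ∧
      inner ℝ (H t1 x1 v) v ≤ δ * E * (8 * (inner ℝ x1 v) ^ 2 + 4 * A * ‖v‖ ^ 2) := by
    intro v
    have hline : ∀ s : ℝ, HasDerivAt (fun s : ℝ => x1 + s • v) v s := by
      intro s
      simpa using ((hasDerivAt_id s).smul_const v).const_add x1
    set i : ℝ := inner ℝ x1 v with hi
    set q : ℝ := ‖v‖ ^ 2 with hq
    have hP : ∀ s : ℝ, HasDerivAt (fun s : ℝ => A + 2 * s * i + s ^ 2 * q) (2 * i + 2 * s * q) s := by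
      intro s
      have h1 := ((((hasDerivAt_id s).const_mul 2).mul_const i).const_add A).add
        (((hasDerivAt_id s).pow 2).mul_const q)
      refine HasDerivAt.congr_deriv h1 ?_
      simp
    have hf : ∀ s : ℝ, HasDerivAt (fun s : ℝ => ψ (t1, x1 + s • v))
        (inner ℝ (G t1 (x1 + s • v)) v -
          δ * (E * (2 * (A + 2 * s * i + s ^ 2 * q) * (2 * i + 2 * s * q)))) s := by
      intro s
      have h1 : HasDerivAt (fun s : ℝ => w t1 (x1 + s • v)) (inner ℝ (G t1 (x1 + s • v)) v) s := by
        have := (hG t1 (x1 + s • v)).comp_hasDerivAt s (hline s)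
        exact this
      have h2 := (((hP s).pow 2).const_mul E).const_mul δ
      have h3 := h1.sub h2
      have hfun : (fun s : ℝ => ψ (t1, x1 + s • v)) = fun s : ℝ => w t1 (x1 + s • v) -
          δ * (E * (A + 2 * s * i + s ^ 2 * q) ^ 2) := by
        funext s
        simp only [hψ]
        rw [quartic_line]
      rw [hfun]
      refine HasDerivAt.congr_deriv h3 ?_
      simp
    have hf' : HasDerivAt (fun s : ℝ => inner ℝ (G t1 (x1 + s • v)) v -
          δ * (E * (2 * (A + 2 * s * i + s ^ 2 * q) * (2 * i + 2 * s * q))))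
        (inner ℝ (H t1 x1 v) v - δ * E * (8 * i ^ 2 + 4 * A * q)) 0 := by
      have h1 : HasDerivAt (fun s : ℝ => inner ℝ (G t1 (x1 + s • v)) v)
          (inner ℝ (H t1 x1 v) v) 0 := by
        have hGl : HasDerivAt (fun s : ℝ => G t1 (x1 + s • v)) (H t1 x1 v) 0 := by
          have := (hH t1 (x1 + (0:ℝ) • v)).comp_hasDerivAt (0:ℝ) (hline 0)
          rw [zero_smul, add_zero] at this
          exact this
        have := hGl.inner ℝ (hasDerivAt_const (0:ℝ) v)
        simpa using this
      have hQ : HasDerivAt (fun s : ℝ => 2 * i + 2 * s * q) (2 * q) 0 := by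
        have := ((((hasDerivAt_id (0:ℝ)).const_mul 2).mul_const q).const_add (2 * i))
        simpa using this
      have h2 := (((((hP 0).const_mul 2).mul hQ)).const_mul E).const_mul δ
      have h3 := h1.sub h2
      refine HasDerivAt.congr_deriv h3 ?_
      simp
      ring
    have hm : ∀ s : ℝ, ψ (t1, x1 + s • v) ≤ ψ (t1, x1 + (0:ℝ) • v) := by
      intro s
      simpa using hglob t1 ht1 (x1 + s • v)
    obtain ⟨ha, hb'⟩ := second_deriv_test hf hf' hm
    simp at ha
    constructor
    · linarith
    · linarith
  have hGeq : G t1 x1 = (δ * E * (4 * A)) • x1 := by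
    apply ext_inner_right ℝ
    intro v
    rw [(hspace v).1, real_inner_smul_left]
    ring
  have hn : ‖x1‖ ≤ A := by rw [hA]; nlinarith [sq_nonneg (‖x1‖ - 1), norm_nonneg x1]
  have hdrift : inner ℝ (b t1 x1) (G t1 x1) ≤ δ * E * (8 * C * A ^ 2) := by
    rw [hGeq, real_inner_smul_right]
    have h1 : inner ℝ (b t1 x1) x1 ≤ C * (1 + ‖x1‖) * ‖x1‖ :=
      (real_inner_le_norm _ _).trans
        (mul_le_mul_of_nonneg_right (hb t1 ht1 x1) (norm_nonneg _))
    have h2 : (1 + ‖x1‖) * ‖x1‖ ≤ 2 * A := by rw [hA] at *; nlinarith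
    have h3 : C * (1 + ‖x1‖) * ‖x1‖ ≤ C * (2 * A) := by
      rw [mul_assoc]; exact mul_le_mul_of_nonneg_left h2 hC
    calc δ * E * (4 * A) * inner ℝ (b t1 x1) x1 ≤ δ * E * (4 * A) * (C * (2 * A)) :=
          mul_le_mul_of_nonneg_left (h1.trans h3) (by positivity)
      _ = _ := by ring
  have htrace : LinearMap.trace ℝ (EuclideanSpace ℝ (Fin d)) (H t1 x1).toLinearMap
      ≤ d * (δ * E * (12 * A ^ 2)) := by
    rw [LinearMap.trace_eq_sum_inner _ (EuclideanSpace.basisFun (Fin d) ℝ)]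
    have hterm : ∀ j ∈ (Finset.univ : Finset (Fin d)),
        inner ℝ (EuclideanSpace.basisFun (Fin d) ℝ j)
          ((H t1 x1).toLinearMap (EuclideanSpace.basisFun (Fin d) ℝ j)) ≤ δ * E * (12 * A ^ 2) := by
      intro j _
      have hv : ‖EuclideanSpace.basisFun (Fin d) ℝ j‖ = 1 :=
        (EuclideanSpace.basisFun (Fin d) ℝ).orthonormal.1 j
      generalize EuclideanSpace.basisFun (Fin d) ℝ j = v at hv
      have h1 := (hspace v).2
      rw [hv] at h1
      have h2 : |inner ℝ x1 v| ≤ ‖x1‖ := by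
        have := abs_real_inner_le_norm x1 v
        rwa [hv, mul_one] at this
      have h3 : (inner ℝ x1 v) ^ 2 ≤ ‖x1‖ ^ 2 := sq_le_sq' (by linarith [abs_le.1 h2]) (abs_le.1 h2).2
      rw [real_inner_comm]
      refine h1.trans (mul_le_mul_of_nonneg_left ?_ (by positivity))
      nlinarith
    refine (Finset.sum_le_sum hterm).trans ?_
    simp
  have hp := hpde t1 ht1pos ht1.2 x1
  have h8 := mul_le_mul_of_nonneg_left htrace hε.le
  have h9 : 0 < δ * E * A ^ 2 := by positivity
  have h10 : δ * (lam * E * A ^ 2) = δ * E * (8 * C * A ^ 2) + ε * (d * (δ * E * (12 * A ^ 2)))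
      + δ * E * A ^ 2 := by rw [hlam]; ring
  linarith

lemma u_bounds {d : ℕ} {T M : ℝ} (hM : 0 ≤ M)
    (u : ℝ → EuclideanSpace ℝ (Fin d) → ℝ)
    (hut : ∀ x, Continuous (fun t => u t x))
    (hG : ∀ t x, HasFDerivAt (u t) (innerSL ℝ (gradient (u t) x)) x)
    (hH : ∀ t x, HasFDerivAt (gradient (u t)) (hessAt (u t) x) x)
    (hh : ∀ t ∈ Set.Icc (0:ℝ) T, ∀ x, ‖hessAt (u t) x‖ ≤ M) :
    ∃ C : ℝ, 0 ≤ C ∧ (∀ t ∈ Set.Icc 0 T, ∀ x, ‖gradient (u t) x‖ ≤ C * (1 + ‖x‖)) ∧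
      (∀ t ∈ Set.Icc 0 T, ∀ x, |u t x| ≤ C * (1 + ‖x‖ ^ 2)) ∧
      ∀ r : ℝ, ContinuousOn (fun p : ℝ × EuclideanSpace ℝ (Fin d) => u p.1 p.2)
      (Set.Icc 0 T ×ˢ Metric.closedBall 0 r) := by
  have hbd : ∀ x, ∃ B, ∀ t ∈ Set.Icc 0 T, |u t x| ≤ B := by
    intro x
    obtain ⟨B, hB⟩ := isCompact_Icc.exists_bound_of_continuousOn
      (s := Set.Icc 0 T) (hut x).continuousOn
    exact ⟨B, fun t ht => hB t ht⟩
  choose B hB using hbd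
  have hlip : ∀ t ∈ Set.Icc 0 T, ∀ x y, ‖gradient (u t) y - gradient (u t) x‖ ≤ M * ‖y - x‖ := by
    intro t ht x y
    exact convex_univ.norm_image_sub_le_of_norm_hasFDerivWithin_le
      (fun z _ => (hH t z).hasFDerivWithinAt) (fun z _ => hh t ht z) (Set.mem_univ x)
      (Set.mem_univ y)
  let e : Fin d → EuclideanSpace ℝ (Fin d) := EuclideanSpace.basisFun (Fin d) ℝ
  have he : ∀ j, ‖e j‖ = 1 := (EuclideanSpace.basisFun (Fin d) ℝ).orthonormal.1
  have hcoord : ∀ t ∈ Set.Icc 0 T, ∀ j,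
      |inner ℝ (gradient (u t) 0) (e j)| ≤ |B (e j)| + |B 0| + M := by
    intro t ht j
    have h1 := (convex_closedBall (0 : EuclideanSpace ℝ (Fin d)) 1).norm_image_sub_le_of_norm_hasFDerivWithin_le'
      (f := u t) (φ := innerSL ℝ (gradient (u t) 0)) (C := M) (x := 0) (y := e j)
      (fun z _ => (hG t z).hasFDerivWithinAt) (fun z hz => by
        rw [← map_sub, innerSL_apply_norm]
        refine (hlip t ht 0 z).trans ?_
        have : ‖z - 0‖ ≤ 1 := by simpa using hz
        nlinarith) (by simp) (by simp [he])
    simp only [sub_zero, he, mul_one, innerSL_apply_apply, Real.norm_eq_abs] at h1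
    have h2 := hB (e j) t ht
    have h3 := hB 0 t ht
    have h4 := le_abs_self (B (e j))
    have h5 := le_abs_self (B 0)
    rw [abs_le] at *
    constructor <;> linarith
  set D : ℝ := ∑ j, (|B (e j)| + |B 0| + M) with hD
  have hD0 : 0 ≤ D := Finset.sum_nonneg fun j _ => by positivity
  have hg0 : ∀ t ∈ Set.Icc 0 T, ‖gradient (u t) 0‖ ≤ D := by
    intro t ht
    have h1 : gradient (u t) 0 = ∑ j, (inner ℝ (e j) (gradient (u t) 0) : ℝ) • e j :=
      ((EuclideanSpace.basisFun (Fin d) ℝ).sum_repr' _).symm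
    rw [h1]
    refine (norm_sum_le _ _).trans (Finset.sum_le_sum fun j _ => ?_)
    rw [norm_smul, he, mul_one, real_inner_comm]
    exact hcoord t ht j
  have hg : ∀ t ∈ Set.Icc 0 T, ∀ x, ‖gradient (u t) x‖ ≤ D + M * ‖x‖ := by
    intro t ht x
    have h1 := hlip t ht 0 x
    rw [sub_zero] at h1
    have h2 := norm_le_norm_add_norm_sub' (gradient (u t) x) (gradient (u t) 0)
    linarith [hg0 t ht]
  have hul : ∀ t ∈ Set.Icc 0 T, ∀ r, ∀ x ∈ Metric.closedBall (0 : EuclideanSpace ℝ (Fin d)) r,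
      ∀ y ∈ Metric.closedBall (0 : EuclideanSpace ℝ (Fin d)) r,
      ‖u t y - u t x‖ ≤ (D + M * r) * ‖y - x‖ := by
    intro t ht r x hx y hy
    refine (convex_closedBall (0 : EuclideanSpace ℝ (Fin d)) r).norm_image_sub_le_of_norm_hasFDerivWithin_le
      (fun z _ => (hG t z).hasFDerivWithinAt) (fun z hz => ?_) hx hy
    rw [innerSL_apply_norm]
    refine (hg t ht z).trans ?_
    have : ‖z‖ ≤ r := by simpa using hz
    nlinarith
  refine ⟨|B 0| + 2 * D + 2 * M, by positivity, ?_, ?_, ?_⟩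
  · intro t ht x
    have h1 := hg t ht x
    have := norm_nonneg x
    have := abs_nonneg (B 0)
    nlinarith [mul_nonneg (abs_nonneg (B 0)) (norm_nonneg x), mul_nonneg hD0 (norm_nonneg x), mul_nonneg hM (norm_nonneg x)]
  · intro t ht x
    have h1 := hul t ht ‖x‖ 0 (by simp) x (by simp)
    rw [sub_zero, Real.norm_eq_abs] at h1
    have h2 := hB 0 t ht
    have h3 := le_abs_self (B 0)
    have h4 : |u t x| ≤ |u t x - u t 0| + |u t 0| := by
      have := abs_add_le (u t x - u t 0) (u t 0)
      simpa using this
    have h5 : ‖x‖ ≤ 1 + ‖x‖ ^ 2 := by nlinarith [sq_nonneg (‖x‖ - 1), norm_nonneg x]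
    have h6 := mul_le_mul_of_nonneg_left h5 hD0
    nlinarith [mul_nonneg (abs_nonneg (B 0)) (sq_nonneg ‖x‖), mul_nonneg hD0 (sq_nonneg ‖x‖), mul_nonneg hM (sq_nonneg ‖x‖)]
  · intro r
    refine continuousOn_prod_of_continuousOn_lipschitzOnWith' _ (D + M * r).toNNReal ?_ ?_
    · intro t ht
      refine LipschitzOnWith.of_dist_le_mul fun x hx y hy => ?_
      rw [dist_eq_norm, dist_eq_norm]
      refine (hul t ht r y hy x hx).trans ?_
      exact mul_le_mul_of_nonneg_right (Real.le_coe_toNNReal _) (norm_nonneg _)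
    · intro x _
      exact (hut x).continuousOn

/-- Comparison of `σ u` with `σ` times a quadratic barrier, `σ = ±1`. -/
lemma barrier_compare {d : ℕ} {T ε : ℝ} (hε : 0 < ε)
    (u : ℝ → EuclideanSpace ℝ (Fin d) → ℝ)
    (hut : ∀ x, ContDiff ℝ 1 (fun t => u t x))
    (hux : ∀ t, ContDiff ℝ 2 (u t))
    (hhessbdd : ∃ M : ℝ, ∀ t ∈ Set.Icc (0:ℝ) T, ∀ x, ‖hessAt (u t) x‖ ≤ M)
    (σ a L c : ℝ) (hσ : |σ| = 1)
    (hineq : ∀ t : ℝ, 0 < t → t ≤ T → ∀ x,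
      σ * (deriv (fun s => u s x) t - c) ≤
        σ * (‖gradient (u t) x‖ ^ 2 - 4 * L ^ 2 * ‖x‖ ^ 2 + ε * (lapAt (u t) x + 2 * L * d)))
    (hinit : ∀ x, σ * (u 0 x - (a - L * ‖x‖ ^ 2)) ≤ 0) :
    ∀ t ∈ Set.Icc (0:ℝ) T, ∀ x, σ * (u t x - (a - L * ‖x‖ ^ 2 + c * t)) ≤ 0 := by
  obtain ⟨M, hM⟩ := hhessbdd
  have hG : ∀ t x, HasFDerivAt (u t) (innerSL ℝ (gradient (u t) x)) x := by
    intro t x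
    exact (((hux t).differentiable (by norm_num)) x).hasGradientAt.hasFDerivAt
  have hH : ∀ t x, HasFDerivAt (gradient (u t)) (hessAt (u t) x) x := by
    intro t x
    have h1 : ContDiff ℝ 1 (fderiv ℝ (u t)) := (hux t).fderiv_right (by norm_num)
    have h2 : Differentiable ℝ (gradient (u t)) := by
      have h3 := h1.differentiable (by norm_num)
      exact (InnerProductSpace.toDual ℝ (EuclideanSpace ℝ (Fin d))).symm.toContinuousLinearEquiv.toContinuousLinearMap.differentiable.comp h3
    exact (h2 x).hasFDerivAt
  obtain ⟨C, hC, hCg, hCu, hcont⟩ := u_bounds (T := T) (M := |M|) (abs_nonneg M) u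
    (fun x => (hut x).continuous) hG hH (fun t ht x => (hM t ht x).trans (le_abs_self M))
  refine max_principle (C := C + |a| + 2 * |L| + |c| * |T|) hε (by positivity)
    (fun t x => σ * (u t x - (a - L * ‖x‖ ^ 2 + c * t)))
    (fun t x => σ • (gradient (u t) x + (2 * L) • x))
    (fun t x => gradient (u t) x - (2 * L) • x)
    (fun t x => σ • (hessAt (u t) x + (2 * L) • ContinuousLinearMap.id ℝ _))
    (fun t x => σ * (deriv (fun s => u s x) t - c)) ?_ ?_ ?_ ?_ ?_ ?_ ?_ ?_
  · intro t x
    have h1 : HasDerivAt (fun s => u s x) (deriv (fun s => u s x) t) t :=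
      (((hut x).differentiable (by norm_num)) t).hasDerivAt
    have h2 := (h1.sub (((hasDerivAt_id t).const_mul c).const_add (a - L * ‖x‖ ^ 2))).const_mul σ
    simpa using h2
  · intro t x
    have h1 : HasFDerivAt (fun x : EuclideanSpace ℝ (Fin d) => ‖x‖ ^ 2) (2 • innerSL ℝ x) x :=
      (hasStrictFDerivAt_norm_sq x).hasFDerivAt
    have h2 := ((hG t x).sub (((h1.const_mul L).const_sub a).add_const (c * t))).const_mul σ
    refine h2.congr_fderiv ?_
    ext v
    simp
    left
    ring
  · intro t x
    exact ((hH t x).add ((hasFDerivAt_id x).const_smul (2 * L))).const_smul σ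
  · intro r
    have := hcont r
    fun_prop
  · intro t ht x
    have h1 := hCu t ht x
    have h2 : |u t x - (a - L * ‖x‖ ^ 2 + c * t)| ≤ |u t x| + |a| + |L| * ‖x‖ ^ 2 + |c| * |T| := by
      have e1 : |L * ‖x‖ ^ 2| = |L| * ‖x‖ ^ 2 := by rw [abs_mul, abs_of_nonneg (sq_nonneg ‖x‖)]
      have e2 : |c * t| ≤ |c| * |T| := by
        rw [abs_mul]
        exact mul_le_mul_of_nonneg_left (abs_le_abs_of_nonneg ht.1 ht.2) (abs_nonneg c)
      calc |u t x - (a - L * ‖x‖ ^ 2 + c * t)| = |u t x + -a + L * ‖x‖ ^ 2 + -(c * t)| := by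
            congr 1; ring
        _ ≤ |u t x| + |-a| + |L * ‖x‖ ^ 2| + |-(c * t)| :=
            (abs_add_le _ _).trans (add_le_add (abs_add_three _ _ _) le_rfl)
        _ ≤ _ := by rw [abs_neg, abs_neg, e1]; linarith
    have h3 : σ * (u t x - (a - L * ‖x‖ ^ 2 + c * t)) ≤ |u t x - (a - L * ‖x‖ ^ 2 + c * t)| := by
      refine (le_abs_self _).trans ?_
      rw [abs_mul, hσ, one_mul]
    have h4 := sq_nonneg ‖x‖
    nlinarith [mul_nonneg (abs_nonneg a) h4, mul_nonneg (abs_nonneg L) h4, abs_nonneg L,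
      mul_nonneg (mul_nonneg (abs_nonneg c) (abs_nonneg T)) h4]
  · intro t ht x
    have h1 := hCg t ht x
    have h2 := norm_sub_le (gradient (u t) x) ((2 * L) • x)
    rw [norm_smul, Real.norm_eq_abs, abs_mul, abs_two] at h2
    have h4 := norm_nonneg x
    have h5 := mul_nonneg (abs_nonneg c) (abs_nonneg T)
    nlinarith [mul_nonneg (abs_nonneg a) h4, abs_nonneg a, abs_nonneg L,
      mul_nonneg h5 h4]
  · intro t ht htT x
    refine (hineq t ht htT x).trans (le_of_eq ?_)
    have e1 : inner ℝ (gradient (u t) x - (2 * L) • x) (σ • (gradient (u t) x + (2 * L) • x))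
        = σ * (‖gradient (u t) x‖ ^ 2 - 4 * L ^ 2 * ‖x‖ ^ 2) := by
      rw [real_inner_smul_right, inner_sub_left, inner_add_right, inner_add_right,
        real_inner_smul_left, real_inner_smul_left, real_inner_smul_right, real_inner_smul_right,
        real_inner_self_eq_norm_sq, real_inner_self_eq_norm_sq,
        real_inner_comm x (gradient (u t) x)]
      ring
    have e2 : LinearMap.trace ℝ (EuclideanSpace ℝ (Fin d))
        (σ • (hessAt (u t) x + (2 * L) • ContinuousLinearMap.id ℝ _)).toLinearMap
        = σ * (lapAt (u t) x + 2 * L * d) := by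
      simp [lapAt]
      ring
    rw [e1, e2]
    ring
  · intro x
    simpa using hinit x

/-- Quadratic barrier bounds for the viscous Hamilton–Jacobi equation
`∂ₜu_ε = |∇ₓu_ε|² + R(x, I(t)) + εΔu_ε` on `(0,T] × ℝ^d`.
Here `K0 = K̄₀`, `K1 = K̄₁`, `K1' = K̲₁`, `L0 = L̄₀`, `L0' = L̲₀`, `L1 = L̄₁`, `L1' = L̲₁`. -/
theorem quadratic_barrier_bounds (d : ℕ) (hd : 1 ≤ d) (T ε IM : ℝ)
    (hT : 0 < T) (hε : 0 < ε) (hIM : 0 < IM)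
    (K0 K1 K1' L0 L0' L1 L1' : ℝ)
    (hK0 : 0 < K0) (hK1 : 0 < K1) (hK1' : 0 < K1')
    (hL0 : 0 < L0) (hL0' : 0 < L0') (hL1 : 0 < L1) (hL1' : 0 < L1')
    (hcomp1 : 4 * L1 ^ 2 ≤ K1) (hcomp2 : K1' ≤ 4 * L1' ^ 2)
    (R : EuclideanSpace ℝ (Fin d) × ℝ → ℝ) (hRcont : Continuous R)
    (hRbound : ∀ x, ∀ I ∈ Set.Icc (0:ℝ) IM,
      -K1' * ‖x‖ ^ 2 ≤ R (x, I) ∧ R (x, I) ≤ K0 - K1 * ‖x‖ ^ 2)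
    (I : ℝ → ℝ) (hI : ContinuousOn I (Set.Icc 0 T))
    (hIrange : ∀ t ∈ Set.Icc (0:ℝ) T, I t ∈ Set.Icc (0:ℝ) IM)
    (u : ℝ → EuclideanSpace ℝ (Fin d) → ℝ)
    (hut : ∀ x, ContDiff ℝ 1 (fun t => u t x))
    (hux : ∀ t, ContDiff ℝ 2 (u t))
    (hhessbdd : ∃ M : ℝ, ∀ t ∈ Set.Icc (0:ℝ) T, ∀ x, ‖hessAt (u t) x‖ ≤ M)
    (heq : ∀ t : ℝ, 0 < t → t ≤ T → ∀ x,
      deriv (fun s => u s x) t = ‖gradient (u t) x‖ ^ 2 + R (x, I t) + ε * lapAt (u t) x)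
    (hinit : ∀ x, -L0' - L1' * ‖x‖ ^ 2 ≤ u 0 x ∧ u 0 x ≤ L0 - L1 * ‖x‖ ^ 2) :
    ∀ t ∈ Set.Icc (0:ℝ) T, ∀ x,
      -L0' - L1' * ‖x‖ ^ 2 - 2 * d * ε * L1' * t ≤ u t x ∧
      u t x ≤ L0 - L1 * ‖x‖ ^ 2 + (K0 + 2 * d * ε * L1) * t := by
  intro t ht x
  constructor
  · have h := barrier_compare (T := T) hε u hut hux hhessbdd (-1) (-L0') L1' (-(2 * d * ε * L1'))
      (by simp) (fun s hs hsT y => by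
        rw [heq s hs hsT y]
        have h1 := (hRbound y (I s) (hIrange s ⟨hs.le, hsT⟩)).1
        have h2 := mul_le_mul_of_nonneg_right hcomp2 (sq_nonneg ‖y‖)
        nlinarith) (fun y => by linarith [(hinit y).1]) t ht x
    linarith
  · have h := barrier_compare (T := T) hε u hut hux hhessbdd 1 L0 L1 (K0 + 2 * d * ε * L1)
      (by simp) (fun s hs hsT y => by
        rw [heq s hs hsT y]
        have h1 := (hRbound y (I s) (hIrange s ⟨hs.le, hsT⟩)).2
        have h2 := mul_le_mul_of_nonneg_right hcomp1 (sq_nonneg ‖y‖)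
        have h3 : 0 ≤ d * ε * L1 := by positivity
        nlinarith) (fun y => by linarith [(hinit y).2]) t ht x
    linarith
end

section
/- Let C > 0, K > 0, I⁰ > 0, T > 0 and M > 0 be constants. There exists ε₀ > 0 such that for every ε ∈ (0, ε₀) and every continuously differentiable function f : [0,T] → [0,∞) satisfying f(0) ≤ M and f'(t) ≤ C − (K/ε)·(I⁰/2 − ∫₀ᵗ f(s) ds)·f(t) for all t ∈ [0,T], one has ∫₀ᵀ f(s) ds ≤ I⁰/4. -/
open intervalIntegral

/-- The bootstrap estimate on the negative part of `J_ε`. For constants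
`C, K, I⁰, T, M > 0` there is `ε₀ > 0` such that for every `ε ∈ (0, ε₀)` and every
nonnegative `C¹` function `f` on `[0,T]` with `f(0) ≤ M` satisfying
`f'(t) ≤ C − (K/ε)(I⁰/2 − ∫₀ᵗ f) f(t)`, one has `∫₀ᵀ f ≤ I⁰/4`. -/
theorem bootstrap_negative_part (C K I0 T M : ℝ)
    (hC : 0 < C) (hK : 0 < K) (hI0 : 0 < I0) (hT : 0 < T) (hM : 0 < M) :
    ∃ ε₀ > (0:ℝ), ∀ ε : ℝ, 0 < ε → ε < ε₀ →
      ∀ f : ℝ → ℝ, ContDiff ℝ 1 f → (∀ t ∈ Set.Icc (0:ℝ) T, 0 ≤ f t) → f 0 ≤ M →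
      (∀ t ∈ Set.Icc (0:ℝ) T,
        deriv f t ≤ C - (K / ε) * (I0 / 2 - ∫ s in (0:ℝ)..t, f s) * f t) →
      (∫ s in (0:ℝ)..T, f s) ≤ I0 / 4 := by
  have hMC : 0 < M + C * T := by positivity
  refine ⟨3 * I0 ^ 2 * K / (32 * (M + C * T)), by positivity, ?_⟩
  intro ε hε hε0 f hf hpos hf0 hder
  by_contra hcon
  push Not at hcon
  have hcont : Continuous f := hf.continuous
  have hFd : ∀ t, HasDerivAt (fun t => ∫ s in (0:ℝ)..t, f s) (f t) t := fun t =>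
    integral_hasDerivAt_right (hcont.intervalIntegrable _ _)
      hcont.stronglyMeasurable.stronglyMeasurableAtFilter hcont.continuousAt
  generalize hFdef : (fun t => ∫ s in (0:ℝ)..t, f s) = F at hFd
  have hFe : ∀ t, (∫ s in (0:ℝ)..t, f s) = F t := fun t => congrFun hFdef t
  have hF0 : F 0 = 0 := by rw [← hFe]; simp
  simp only [hFe] at hcon hder
  have hFc : Continuous F := continuous_iff_continuousAt.2 fun t => (hFd t).continuousAt
  obtain ⟨t, ht, hFt⟩ : ∃ t ∈ Set.Icc (0:ℝ) T, F t = I0 / 4 := by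
    have := intermediate_value_Icc hT.le hFc.continuousOn
    exact this ⟨by rw [hF0]; positivity, hcon.le⟩
  have hG : ∀ x, HasDerivAt (fun x => f x + (K / ε) * (I0 / 2 * F x - F x ^ 2 / 2) - C * x)
      (deriv f x + (K / ε) * (I0 / 2 - F x) * f x - C) x := by
    intro x
    have h1 : HasDerivAt f (deriv f x) x := (hf.differentiable (by norm_num) x).hasDerivAt
    have h2 := (((hFd x).const_mul (I0 / 2)).sub (((hFd x).pow 2).div_const 2)).const_mul (K / ε)
    have h3 := (h1.add h2).sub ((hasDerivAt_id x).const_mul C)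
    refine h3.congr_deriv ?_
    push_cast
    ring
  have hanti : AntitoneOn
      (fun x => f x + (K / ε) * (I0 / 2 * F x - F x ^ 2 / 2) - C * x) (Set.Icc 0 T) := by
    apply antitoneOn_of_deriv_nonpos (convex_Icc 0 T)
    · exact fun x _ => (hG x).continuousAt.continuousWithinAt
    · exact fun x _ => (hG x).differentiableAt.differentiableWithinAt
    · intro x hx
      rw [(hG x).deriv]
      linarith [hder x (interior_subset hx)]
  have h := hanti (Set.left_mem_Icc.2 hT.le) ht ht.1
  simp only [hF0, hFt] at h
  have h1 := hpos t ht
  have h2 : C * t ≤ C * T := mul_le_mul_of_nonneg_left ht.2 hC.le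
  have h3 : (K / ε) * (3 * I0 ^ 2 / 32) ≤ M + C * T := by nlinarith
  rw [lt_div_iff₀ (by positivity)] at hε0
  have h4 : (K / ε) * (3 * I0 ^ 2 / 32) = K * (3 * I0 ^ 2 / 32) / ε := by ring
  rw [h4, div_le_iff₀ hε] at h3
  linarith
end

section
/- Let d ≥ 1 and let L̄₀, L̄₁ > 0. For each ε > 0 let u_ε : ℝ^d → ℝ be continuous with u_ε(x) ≤ L̄₀ − L̄₁|x|² for all x, and let u : ℝ^d → ℝ be continuous such that u_ε → u uniformly on every compact subset of ℝ^d as ε → 0. Suppose u has a unique global maximum point x̄ ∈ ℝ^d, i.e. u(x) < u(x̄) for all x ≠ x̄. Then for every bounded continuous function φ : ℝ^d → ℝ, (∫_{ℝ^d} φ(x) e^{u_ε(x)/ε} dx) / (∫_{ℝ^d} e^{u_ε(x)/ε} dx) → φ(x̄) as ε → 0. -/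
open MeasureTheory

lemma aux_gauss (d : ℕ) {a : ℝ} (ha : 0 < a) :
    Integrable (fun x : EuclideanSpace ℝ (Fin d) => Real.exp (-a * ‖x‖ ^ 2)) := by
  by_contra h
  have h1 := GaussianFourier.integral_rexp_neg_mul_sq_norm (V := EuclideanSpace ℝ (Fin d)) ha
  rw [integral_undef h] at h1
  have : 0 < (Real.pi / a) ^ (Module.finrank ℝ (EuclideanSpace ℝ (Fin d)) / 2 : ℝ) :=
    Real.rpow_pos_of_pos (by positivity) _
  linarith

lemma aux_key (d : ℕ) (L0 L1 : ℝ) (hL1 : 0 < L1)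
    (u : ℝ → EuclideanSpace ℝ (Fin d) → ℝ)
    (hubound : ∀ ε > (0:ℝ), ∀ x, u ε x ≤ L0 - L1 * ‖x‖ ^ 2)
    (ulim : EuclideanSpace ℝ (Fin d) → ℝ) (hulim : Continuous ulim)
    (hconv : ∀ K : Set (EuclideanSpace ℝ (Fin d)), IsCompact K →
      TendstoUniformlyOn u ulim (nhdsWithin 0 (Set.Ioi 0)) K)
    (xbar : EuclideanSpace ℝ (Fin d))
    (hmax : ∀ x, x ≠ xbar → ulim x < ulim xbar) (δ : ℝ) (hδ : 0 < δ) :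
    ∃ γ > 0, ∃ a > 0, ∀ᶠ ε in nhdsWithin (0:ℝ) (Set.Ioi 0), ∀ x, x ∉ Metric.ball xbar δ →
      u ε x ≤ ulim xbar - 2 * γ - a * ‖x‖ ^ 2 := by
  obtain ⟨R, hR0, hR⟩ : ∃ R : ℝ, 0 ≤ R ∧ L0 - ulim xbar + 1 ≤ L1 / 2 * R ^ 2 := by
    refine ⟨Real.sqrt (|L0 - ulim xbar + 1| * 2 / L1), Real.sqrt_nonneg _, ?_⟩
    rw [Real.sq_sqrt (by positivity)]
    have : L1 / 2 * (|L0 - ulim xbar + 1| * 2 / L1) = |L0 - ulim xbar + 1| := by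
      field_simp
    rw [this]
    exact le_abs_self _
  have hK : IsCompact (Metric.closedBall (0 : EuclideanSpace ℝ (Fin d)) R \ Metric.ball xbar δ) :=
    (isCompact_closedBall _ _).diff Metric.isOpen_ball
  set K := Metric.closedBall (0 : EuclideanSpace ℝ (Fin d)) R \ Metric.ball xbar δ with hKd
  obtain ⟨g, hg0, hg⟩ : ∃ g > 0, ∀ x ∈ K, ulim x ≤ ulim xbar - g := by
    rcases K.eq_empty_or_nonempty with h | h
    · exact ⟨1, one_pos, by simp [h]⟩
    · obtain ⟨y, hy, hy2⟩ := hK.exists_isMaxOn h hulim.continuousOn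
      refine ⟨ulim xbar - ulim y, ?_, fun x hx => ?_⟩
      · have : y ≠ xbar := by
          rintro rfl
          exact hy.2 (Metric.mem_ball_self hδ)
        have := hmax y this
        linarith
      · have : ulim x ≤ ulim y := hy2 hx
        linarith
  set γ := min (g / 4) (1 / 2) with hγ
  have hγ0 : 0 < γ := by positivity
  have hγ1 : γ ≤ g / 4 := min_le_left _ _
  have hγ2 : γ ≤ 1 / 2 := min_le_right _ _
  refine ⟨γ, hγ0, min (L1 / 2) (γ / (R ^ 2 + 1)), by positivity, ?_⟩
  set a := min (L1 / 2) (γ / (R ^ 2 + 1)) with had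
  have ha0 : 0 < a := by positivity
  have ha1 : a ≤ L1 / 2 := min_le_left _ _
  have ha2 : a * (R ^ 2 + 1) ≤ γ := by
    rw [← le_div_iff₀ (by positivity)]
    exact min_le_right _ _
  have hc := Metric.tendstoUniformlyOn_iff.1 (hconv K hK) γ hγ0
  filter_upwards [hc, self_mem_nhdsWithin] with ε hε hpos x hx
  by_cases hxR : ‖x‖ ≤ R
  · have hxK : x ∈ K := ⟨by simpa using hxR, hx⟩
    have h1 := hε x hxK
    rw [Real.dist_eq, abs_lt] at h1
    have h2 := hg x hxK
    have h3 : ‖x‖ ^ 2 ≤ R ^ 2 := by gcongr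
    have h4 : a * ‖x‖ ^ 2 ≤ a * (R ^ 2 + 1) := by gcongr; linarith
    linarith
  · have h1 := hubound ε hpos x
    have h3 : R ^ 2 ≤ ‖x‖ ^ 2 := by
      have := (not_le.1 hxR).le
      gcongr
    have h4 : L1 / 2 * R ^ 2 ≤ L1 / 2 * ‖x‖ ^ 2 := by gcongr
    have h5 : a * ‖x‖ ^ 2 ≤ L1 / 2 * ‖x‖ ^ 2 := by gcongr
    linarith

/-- Laplace-method concentration. If `u_ε ≤ L̄₀ − L̄₁|x|²` uniformly,
`u_ε → u` uniformly on compact sets as `ε → 0⁺`, and `u` has a unique global maximum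
point `x̄`, then for every bounded continuous `φ`,
`(∫ φ e^{u_ε/ε}) / (∫ e^{u_ε/ε}) → φ(x̄)` as `ε → 0⁺`. -/
theorem laplace_concentration (d : ℕ) (hd : 1 ≤ d) (L0 L1 : ℝ)
    (hL0 : 0 < L0) (hL1 : 0 < L1)
    (u : ℝ → EuclideanSpace ℝ (Fin d) → ℝ)
    (hucont : ∀ ε > (0:ℝ), Continuous (u ε))
    (hubound : ∀ ε > (0:ℝ), ∀ x, u ε x ≤ L0 - L1 * ‖x‖ ^ 2)
    (ulim : EuclideanSpace ℝ (Fin d) → ℝ) (hulim : Continuous ulim)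
    (hconv : ∀ K : Set (EuclideanSpace ℝ (Fin d)), IsCompact K →
      TendstoUniformlyOn u ulim (nhdsWithin 0 (Set.Ioi 0)) K)
    (xbar : EuclideanSpace ℝ (Fin d))
    (hmax : ∀ x, x ≠ xbar → ulim x < ulim xbar) :
    ∀ φ : EuclideanSpace ℝ (Fin d) → ℝ, Continuous φ → (∃ Mφ : ℝ, ∀ x, |φ x| ≤ Mφ) →
      Filter.Tendsto
        (fun ε => (∫ x, φ x * Real.exp (u ε x / ε)) / (∫ x, Real.exp (u ε x / ε)))
        (nhdsWithin 0 (Set.Ioi 0)) (nhds (φ xbar)) := by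
  rintro φ hφ ⟨M, hM⟩
  have hM0 : 0 ≤ M := (abs_nonneg _).trans (hM 0)
  rw [Metric.tendsto_nhds]
  intro η hη
  obtain ⟨δ, hδ, hδφ⟩ := Metric.continuous_iff.1 hφ xbar (η / 2) (by positivity)
  obtain ⟨γ, hγ, a, ha, hev⟩ :=
    aux_key d L0 L1 hL1 u hubound ulim hulim hconv xbar hmax δ hδ
  obtain ⟨r, hr, hru⟩ := Metric.continuous_iff.1 hulim xbar (γ / 2) (by positivity)
  have hG := aux_gauss d ha
  set C := ∫ x : EuclideanSpace ℝ (Fin d), Real.exp (-a * ‖x‖ ^ 2) with hC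
  have hC0 : 0 ≤ C := integral_nonneg fun x => (Real.exp_pos _).le
  set c := (volume : Measure (EuclideanSpace ℝ (Fin d))).real (Metric.ball xbar r) with hcd
  have hc0 : 0 < c := by
    rw [hcd, measureReal_def]
    exact ENNReal.toReal_pos (Metric.measure_ball_pos _ _ hr).ne' measure_ball_lt_top.ne
  have hlim : Filter.Tendsto (fun ε : ℝ => 2 * M * C / c * Real.exp (-(γ * ε⁻¹)))
      (nhdsWithin 0 (Set.Ioi 0)) (nhds 0) := by
    have h1 : Filter.Tendsto (fun ε : ℝ => γ * ε⁻¹) (nhdsWithin 0 (Set.Ioi 0)) Filter.atTop :=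
      tendsto_inv_nhdsGT_zero.const_mul_atTop hγ
    simpa using (Real.tendsto_exp_neg_atTop_nhds_zero.comp h1).const_mul (2 * M * C / c)
  have hK := Metric.tendstoUniformlyOn_iff.1
    (hconv (Metric.closedBall xbar r) (isCompact_closedBall _ _)) (γ / 2) (by positivity)
  filter_upwards [hev, hK, hlim.eventually (gt_mem_nhds (half_pos hη)), self_mem_nhdsWithin,
    mem_nhdsWithin_of_mem_nhds (Iic_mem_nhds (zero_lt_one' ℝ))] with ε h1 h2 h3 hpos hle
  have hpos : 0 < ε := hpos
  have hle : ε ≤ 1 := hle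
  have hinv : 1 ≤ ε⁻¹ := (one_le_inv₀ hpos).2 hle
  have hcont : Continuous fun x => Real.exp (u ε x / ε) := by
    have := hucont ε hpos
    fun_prop
  have hint : Integrable fun x => Real.exp (u ε x / ε) := by
    refine ((aux_gauss d hL1).const_mul (Real.exp (L0 / ε))).mono' hcont.aestronglyMeasurable ?_
    refine Filter.Eventually.of_forall fun x => ?_
    rw [Real.norm_eq_abs, abs_of_pos (Real.exp_pos _), ← Real.exp_add]
    apply Real.exp_le_exp.2
    have e1 : u ε x * ε⁻¹ ≤ (L0 - L1 * ‖x‖ ^ 2) * ε⁻¹ := by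
      gcongr
      exact hubound ε hpos x
    have e2 : L1 * ‖x‖ ^ 2 * 1 ≤ L1 * ‖x‖ ^ 2 * ε⁻¹ := by gcongr
    rw [div_eq_mul_inv, div_eq_mul_inv]
    linarith
  set D := ∫ x, Real.exp (u ε x / ε) with hD
  have hDlow : c * Real.exp ((ulim xbar - γ) * ε⁻¹) ≤ D := by
    have e1 : ∫ x in Metric.ball xbar r, Real.exp ((ulim xbar - γ) * ε⁻¹)
        ≤ ∫ x in Metric.ball xbar r, Real.exp (u ε x / ε) := by
      refine setIntegral_mono_on (integrableOn_const measure_ball_lt_top.ne) hint.integrableOn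
        measurableSet_ball fun x hx => ?_
      apply Real.exp_le_exp.2
      rw [div_eq_mul_inv]
      have f1 := h2 x (Metric.ball_subset_closedBall hx)
      have f2 := hru x hx
      rw [Real.dist_eq, abs_lt] at f1 f2
      gcongr
      linarith
    rw [setIntegral_const, smul_eq_mul] at e1
    exact e1.trans (setIntegral_le_integral hint
      (Filter.Eventually.of_forall fun x => (Real.exp_pos _).le))
  have hDpos : 0 < D := lt_of_lt_of_le (by positivity) hDlow
  have hφint : Integrable fun x => φ x * Real.exp (u ε x / ε) :=
    hint.bdd_mul hφ.aestronglyMeasurable (Filter.Eventually.of_forall hM)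
  have hnum : |(∫ x, φ x * Real.exp (u ε x / ε)) - φ xbar * D| ≤
      η / 2 * D + 2 * M * Real.exp ((ulim xbar - 2 * γ) * ε⁻¹) * C := by
    rw [hD, hC, ← integral_const_mul, ← integral_const_mul, ← integral_const_mul,
      ← integral_sub hφint (hint.const_mul _),
      ← integral_add (hint.const_mul _) (hG.const_mul _), ← Real.norm_eq_abs]
    refine norm_integral_le_of_norm_le ((hint.const_mul _).add (hG.const_mul _))
      (Filter.Eventually.of_forall fun x => ?_)
    rw [← sub_mul, norm_mul, Real.norm_eq_abs, Real.norm_eq_abs, abs_of_pos (Real.exp_pos _)]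
    by_cases hx : x ∈ Metric.ball xbar δ
    · have f := (hδφ x hx).le
      rw [Real.dist_eq] at f
      have f2 : |φ x - φ xbar| * Real.exp (u ε x / ε) ≤ η / 2 * Real.exp (u ε x / ε) := by
        gcongr
      refine f2.trans (le_add_of_nonneg_right ?_)
      positivity
    · have f1 : |φ x - φ xbar| ≤ 2 * M := by
        have := abs_sub (φ x) (φ xbar)
        have := hM x
        have := hM xbar
        linarith
      have f2 : Real.exp (u ε x / ε) ≤
          Real.exp ((ulim xbar - 2 * γ) * ε⁻¹) * Real.exp (-a * ‖x‖ ^ 2) := by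
        rw [← Real.exp_add]
        apply Real.exp_le_exp.2
        have e1 : u ε x * ε⁻¹ ≤ (ulim xbar - 2 * γ - a * ‖x‖ ^ 2) * ε⁻¹ := by
          gcongr
          exact h1 x hx
        have e2 : a * ‖x‖ ^ 2 * 1 ≤ a * ‖x‖ ^ 2 * ε⁻¹ := by gcongr
        rw [div_eq_mul_inv]
        linarith
      have f3 : |φ x - φ xbar| * Real.exp (u ε x / ε) ≤ 2 * M *
          (Real.exp ((ulim xbar - 2 * γ) * ε⁻¹) * Real.exp (-a * ‖x‖ ^ 2)) := by
        gcongr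
      rw [mul_assoc (2 * M)]
      refine f3.trans (le_add_of_nonneg_left ?_)
      positivity
  have hfin : 2 * M * Real.exp ((ulim xbar - 2 * γ) * ε⁻¹) * C < η / 2 * D := by
    have e1 : 2 * M * Real.exp ((ulim xbar - 2 * γ) * ε⁻¹) * C =
        (2 * M * C / c * Real.exp (-(γ * ε⁻¹))) * (c * Real.exp ((ulim xbar - γ) * ε⁻¹)) := by
      have : (ulim xbar - 2 * γ) * ε⁻¹ = -(γ * ε⁻¹) + (ulim xbar - γ) * ε⁻¹ := by ring
      rw [this, Real.exp_add]
      field_simp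
    rw [e1]
    calc _ < η / 2 * (c * Real.exp ((ulim xbar - γ) * ε⁻¹)) := by gcongr
      _ ≤ _ := by gcongr
  rw [Real.dist_eq, div_sub' hDpos.ne', abs_div, abs_of_pos hDpos, div_lt_iff₀ hDpos,
    mul_comm D]
  linarith
end

section
/- Let d ≥ 1, I_M > 0, K̄₁ > 0, K̄₂ > 0, and let R : ℝ^d × [0, I_M] → ℝ be continuously differentiable in I and twice continuously differentiable in x, satisfying: (i) max_{x ∈ ℝ^d} R(x, I_M) = 0 = R(0, I_M); (ii) D²ₓR(x,I) ≤ −2K̄₁·Id as symmetric matrices for all x and all I ∈ [0, I_M]; (iii) ∂R/∂I(x,I) ≤ −K̄₂ for all x and all I ∈ [0, I_M]. If x ∈ ℝ^d and I ∈ [0, I_M] satisfy R(x,I) = 0 and ∇ₓR(x,I) = 0, then I = I_M and x = 0. -/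
open scoped RealInnerProductSpace

/-- A critical point of a function with negative definite Hessian is a strict global maximum. -/
theorem crit_strict_max {d : ℕ} (f : EuclideanSpace ℝ (Fin d) → ℝ) (hf : ContDiff ℝ 2 f)
    (K : ℝ) (hK : 0 < K)
    (hH : ∀ x v, ⟪v, hessAt f x v⟫ ≤ -2 * K * ‖v‖ ^ 2)
    (x : EuclideanSpace ℝ (Fin d)) (hx : gradient f x = 0)
    (y : EuclideanSpace ℝ (Fin d)) (hy : y ≠ x) : f y < f x := by
  have hfd : Differentiable ℝ f := hf.differentiable (by norm_num)
  have hgrad : Differentiable ℝ (gradient f) := by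
    have h1 : ContDiff ℝ 1 (fderiv ℝ f) := hf.fderiv_right (by norm_num)
    have h2 := h1.differentiable (by norm_num)
    exact (InnerProductSpace.toDual ℝ
      (EuclideanSpace ℝ (Fin d))).symm.toContinuousLinearEquiv.differentiable.comp h2
  set v := y - x with hv
  have hv0 : v ≠ 0 := sub_ne_zero.mpr hy
  have hline : ∀ t : ℝ, HasDerivAt (fun t : ℝ => x + t • v) v t := by
    intro t
    simpa using ((hasDerivAt_id t).smul_const v).const_add x
  have hg : ∀ t : ℝ, HasDerivAt (fun t : ℝ => f (x + t • v)) ⟪v, gradient f (x + t • v)⟫ t := by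
    intro t
    have h := ((hfd (x + t • v)).hasGradientAt.hasFDerivAt).comp_hasDerivAt t (hline t)
    rw [real_inner_comm]
    simpa [Function.comp_def] using h
  have hg2 : ∀ t : ℝ, HasDerivAt (fun t : ℝ => ⟪v, gradient f (x + t • v)⟫)
      ⟪v, hessAt f (x + t • v) v⟫ t := by
    intro t
    have h := ((hgrad (x + t • v)).hasFDerivAt).comp_hasDerivAt t (hline t)
    have h3 := (hasDerivAt_const t v).inner ℝ h
    simpa [hessAt] using h3
  have hanti : StrictAnti (fun t : ℝ => ⟪v, gradient f (x + t • v)⟫) := by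
    apply strictAnti_of_deriv_neg
    intro t
    rw [(hg2 t).deriv]
    have : 0 < ‖v‖ := norm_pos_iff.mpr hv0
    have h4 := hH (x + t • v) v
    have : 0 < K * ‖v‖ ^ 2 := by positivity
    linarith
  have hneg : StrictAntiOn (fun t : ℝ => f (x + t • v)) (Set.Icc 0 1) := by
    apply strictAntiOn_of_deriv_neg (convex_Icc 0 1)
    · exact fun t _ => (hg t).continuousAt.continuousWithinAt
    · intro t ht
      rw [interior_Icc] at ht
      rw [(hg t).deriv]
      have h5 := hanti ht.1
      simpa [hx] using h5
  have h6 := hneg (by simp) (by simp) (zero_lt_one' ℝ)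
  simpa [hv] using h6

/-- Identification of the limit point. Under (i) `max R(·,I_M) = 0 = R(0,I_M)`,
(ii) `D²ₓR ≤ −2K̄₁·Id`, (iii) `∂R/∂I ≤ −K̄₂ < 0` on `ℝ^d × [0,I_M]`, any `(x,I)` with
`I ∈ [0,I_M]`, `R(x,I) = 0` and `∇ₓR(x,I) = 0` must equal `(0, I_M)`.
Here `K1 = K̄₁`, `K2 = K̄₂`. -/
theorem limit_identification (d : ℕ) (hd : 1 ≤ d) (IM K1 K2 : ℝ)
    (hIM : 0 < IM) (hK1 : 0 < K1) (hK2 : 0 < K2)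
    (R : EuclideanSpace ℝ (Fin d) × ℝ → ℝ)
    (hRI : ∀ x : EuclideanSpace ℝ (Fin d), ContDiff ℝ 1 (fun J => R (x, J)))
    (hRx : ∀ I ∈ Set.Icc (0:ℝ) IM, ContDiff ℝ 2 (fun x => R (x, I)))
    (hRmax : (∀ x, R (x, IM) ≤ 0) ∧ R (0, IM) = 0)
    (hRhess : ∀ x, ∀ I ∈ Set.Icc (0:ℝ) IM, ∀ v,
      ⟪v, hessAt (fun y => R (y, I)) x v⟫ ≤ -2 * K1 * ‖v‖ ^ 2)
    (hRIdecr : ∀ x, ∀ I ∈ Set.Icc (0:ℝ) IM, deriv (fun J => R (x, J)) I ≤ -K2) :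
    ∀ (x : EuclideanSpace ℝ (Fin d)), ∀ I ∈ Set.Icc (0:ℝ) IM,
      R (x, I) = 0 → gradient (fun y => R (y, I)) x = 0 → I = IM ∧ x = 0 := by
  intro x I hI hR hgr
  have hmono : StrictAntiOn (fun J => R (0, J)) (Set.Icc 0 IM) := by
    apply strictAntiOn_of_deriv_neg (convex_Icc 0 IM)
    · exact (hRI 0).continuous.continuousOn
    · intro t ht
      have := hRIdecr 0 t (interior_subset ht)
      linarith
  have hMm : IM ∈ Set.Icc (0:ℝ) IM := ⟨hIM.le, le_rfl⟩
  have hge : R (0, IM) ≤ R (0, I) := hmono.antitoneOn hI hMm hI.2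
  have hx0 : x = 0 := by
    by_contra hne
    have := crit_strict_max (fun y => R (y, I)) (hRx I hI) K1 hK1
      (fun z v => hRhess z I hI v) x hgr 0 (Ne.symm hne)
    linarith [hRmax.2]
  refine ⟨?_, hx0⟩
  subst hx0
  by_contra hne
  have := hmono hI hMm (lt_of_le_of_ne hI.2 hne)
  simp only at this
  linarith [hRmax.2]
end

section
/- Let d ≥ 1, L̄₁ > 0, η > 0, M₁ > 0, M₂ > 0 and set K = M₁M₂/(2L̄₁η). Let r : ℝ^d → ℝ be continuously differentiable with |∇r(x)| ≤ M₁ for all x, and let C : ℝ^d × ℝ^d → ℝ be continuously differentiable with C(x,y) ≥ η and |∇ₓC(x,y)| ≤ M₂ for all x, y. Let x̄ : [0,∞) → ℝ^d be continuously differentiable, let ρ̄ : [0,∞) → [0,∞) satisfy ρ̄(t)·C(x̄(t), x̄(t)) ≤ max(r(x̄(t)), 0) for all t ≥ 0, and suppose x̄'(t) = A(t)·(∇r(x̄(t)) − ρ̄(t)·∇ₓC(x̄(t), x̄(t))), where for each t the matrix A(t) is symmetric positive semidefinite with A(t) ≤ (1/(2L̄₁))·Id as symmetric matrices. If r(x̄(0))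 > 0, then r(x̄(t)) ≥ r(x̄(0))·e^{−Kt} > 0 for all t ≥ 0. -/
lemma aux_bilin {E : Type*} [NormedAddCommGroup E] [InnerProductSpace ℝ E]
    (T : E →ₗ[ℝ] E) (c M1 M2 : ℝ) (hM1 : 0 < M1) (hM2 : 0 < M2) (hc : 0 ≤ c)
    (hs : ∀ x y, inner ℝ (T x) y = inner ℝ x (T y))
    (hp : ∀ x, 0 ≤ inner ℝ (T x) x) (hu : ∀ x, inner ℝ (T x) x ≤ c * ‖x‖ ^ 2)
    (g h : E) (hg : ‖g‖ ≤ M1) (hh : ‖h‖ ≤ M2) :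
    inner ℝ g (T h) ≤ c * (M1 * M2) := by
  have h1 := hu (M2 • g + M1 • h)
  have h2 := hp (M2 • g - M1 • h)
  have h3 : ‖M2 • g + M1 • h‖ ≤ 2 * (M1 * M2) := by
    refine (norm_add_le _ _).trans ?_
    rw [norm_smul, norm_smul, Real.norm_of_nonneg hM1.le, Real.norm_of_nonneg hM2.le]
    nlinarith
  have h4 : ‖M2 • g + M1 • h‖ ^ 2 ≤ (2 * (M1 * M2)) ^ 2 := by gcongr
  have h5 := mul_le_mul_of_nonneg_left h4 hc
  have h6 := hs g h
  have h7 : inner ℝ (T h) g = inner ℝ g (T h) := real_inner_comm _ _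
  simp only [map_add, map_sub, map_smul, inner_add_left, inner_add_right, inner_sub_left,
    inner_sub_right, real_inner_smul_left, real_inner_smul_right, h6, h7] at h1 h2
  have hm : 0 < M1 * M2 := by positivity
  refine le_of_mul_le_mul_left (a := 4 * (M1 * M2)) ?_ (by positivity)
  nlinarith

lemma aux_ode (f f' : ℝ → ℝ) (K : ℝ) (hf : ∀ t, HasDerivAt f (f' t) t)
    (hK : ∀ t ≥ (0:ℝ), -(K * max (f t) 0) ≤ f' t) (h0 : 0 < f 0) (t : ℝ) (ht : 0 ≤ t) :
    f 0 * Real.exp (-K * t) ≤ f t := by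
  have key : ∀ K' > K, f 0 * Real.exp (-K' * t) ≤ f t := by
    intro K' hK'
    have := image_le_of_deriv_right_lt_deriv_boundary (f := fun s => - f s)
      (f' := fun s => - f' s) (a := 0) (b := t)
      (B := fun s => -(f 0 * Real.exp (-K' * s)))
      (B' := fun s => -(f 0 * (Real.exp (-K' * s) * -K')))
      (fun s _ => (hf s).neg.continuousAt.continuousWithinAt)
      (fun s _ => (hf s).neg.hasDerivWithinAt) (by simp)
      (fun s => by
        have := ((hasDerivAt_id s).const_mul (-K')).exp.const_mul (f 0)
        have h2 := this.neg
        simp only [mul_one, id] at h2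
        exact h2)
      (fun s hs he => by
        have he' : f s = f 0 * Real.exp (-K' * s) := by simpa using he
        have hpos : 0 < f s := by rw [he']; positivity
        have h1 := hK s hs.1
        rw [max_eq_left hpos.le] at h1
        have : -(f 0 * (Real.exp (-K' * s) * -K')) = K' * f s := by rw [he']; ring
        simp only [this]
        nlinarith) (Set.right_mem_Icc.2 ht)
    simpa using this
  have hc : Continuous fun k : ℝ => f 0 * Real.exp (-k * t) := by fun_prop
  exact le_of_tendsto (hc.continuousAt.tendsto.mono_left nhdsWithin_le_nhds)
    (Filter.eventually_of_mem (self_mem_nhdsWithin : Set.Ioi K ∈ nhdsWithin K (Set.Ioi K)) key)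

/-- Persistence for the local-competition canonical dynamics. With
`|∇r| ≤ M₁`, `C ≥ η`, `|∇ₓC| ≤ M₂`, the constraint `ρ̄(t)·C(x̄(t),x̄(t)) ≤ max(r(x̄(t)),0)`,
and the canonical equation `x̄' = A(t)(∇r − ρ̄∇ₓC)` with `0 ≤ A(t) ≤ (1/(2L̄₁))·Id`
symmetric, if `r(x̄(0)) > 0` then `r(x̄(t)) ≥ r(x̄(0))·e^{−Kt} > 0` for all `t ≥ 0`,
where `K = M₁M₂/(2L̄₁η)`.  Here `L1 = L̄₁`. -/
theorem persistence_local_competition (d : ℕ) (hd : 1 ≤ d) (L1 η M1 M2 : ℝ)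
    (hL1 : 0 < L1) (hη : 0 < η) (hM1 : 0 < M1) (hM2 : 0 < M2)
    (r : EuclideanSpace ℝ (Fin d) → ℝ) (hr : ContDiff ℝ 1 r)
    (hgradr : ∀ x, ‖gradient r x‖ ≤ M1)
    (Cc : EuclideanSpace ℝ (Fin d) → EuclideanSpace ℝ (Fin d) → ℝ)
    (hCc : ContDiff ℝ 1 (Function.uncurry Cc))
    (hCclow : ∀ x y, η ≤ Cc x y)
    (hgradC : ∀ x y, ‖gradient (fun z => Cc z y) x‖ ≤ M2)
    (xbar : ℝ → EuclideanSpace ℝ (Fin d)) (hxbar : ContDiff ℝ 1 xbar)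
    (rhobar : ℝ → ℝ) (hrhobar : ∀ t ≥ (0:ℝ), 0 ≤ rhobar t)
    (hconstr : ∀ t ≥ (0:ℝ), rhobar t * Cc (xbar t) (xbar t) ≤ max (r (xbar t)) 0)
    (A : ℝ → Matrix (Fin d) (Fin d) ℝ)
    (hApsd : ∀ t ≥ (0:ℝ), (A t).PosSemidef)
    (hAup : ∀ t ≥ (0:ℝ),
      ((1 / (2 * L1)) • (1 : Matrix (Fin d) (Fin d) ℝ) - A t).PosSemidef)
    (hcano : ∀ t ≥ (0:ℝ), deriv xbar t =
      Matrix.toEuclideanLin (A t)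
        (gradient r (xbar t) - rhobar t • gradient (fun z => Cc z (xbar t)) (xbar t)))
    (h0 : 0 < r (xbar 0)) :
    ∀ t ≥ (0:ℝ),
      r (xbar 0) * Real.exp (-(M1 * M2 / (2 * L1 * η)) * t) ≤ r (xbar t) ∧
      0 < r (xbar t) := by
  have hf : ∀ t, HasDerivAt (fun s => r (xbar s))
      (inner ℝ (gradient r (xbar t)) (deriv xbar t)) t := by
    intro t
    have h1 := (hr.differentiable one_ne_zero (xbar t)).hasFDerivAt
    have h2 := (hxbar.differentiable one_ne_zero t).hasDerivAt
    have h3 := h1.comp_hasDerivAt t h2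
    rw [← toDual_gradient, InnerProductSpace.toDual_apply_apply] at h3
    exact h3
  have hK : ∀ t ≥ (0:ℝ), -((M1 * M2 / (2 * L1 * η)) * max (r (xbar t)) 0) ≤
      inner ℝ (gradient r (xbar t)) (deriv xbar t) := by
    intro t ht
    have hP := Matrix.isPositive_toEuclideanLin_iff.2 (hApsd t ht)
    have hQ := Matrix.isPositive_toEuclideanLin_iff.2 (hAup t ht)
    have hp : ∀ x, 0 ≤ inner ℝ (Matrix.toEuclideanLin (A t) x) x := fun x => by
      simpa using hP.2 x
    have hu : ∀ x, inner ℝ (Matrix.toEuclideanLin (A t) x) x ≤ (1 / (2 * L1)) * ‖x‖ ^ 2 := by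
      intro x
      have h1 := hQ.2 x
      have h2 : Matrix.toEuclideanLin ((1 / (2 * L1)) • (1 : Matrix (Fin d) (Fin d) ℝ) - A t) x
          = (1 / (2 * L1)) • x - Matrix.toEuclideanLin (A t) x := by
        rw [map_sub, map_smul]
        congr 1
        ext i
        simp [Matrix.toLpLin_apply]
      rw [h2, inner_sub_left, real_inner_smul_left, real_inner_self_eq_norm_sq] at h1
      simp only [RCLike.re_to_real] at h1
      linarith
    have hb := aux_bilin (Matrix.toEuclideanLin (A t)) (1 / (2 * L1)) M1 M2 hM1 hM2
      (by positivity) hP.1 hp hu (gradient r (xbar t))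
      (gradient (fun z => Cc z (xbar t)) (xbar t)) (hgradr _) (hgradC _ _)
    have hg := hp (gradient r (xbar t))
    rw [real_inner_comm] at hg
    rw [hcano t ht, map_sub, map_smul, inner_sub_right, real_inner_smul_right]
    have hρ := hrhobar t ht
    have h1 : rhobar t * η ≤ max (r (xbar t)) 0 :=
      (mul_le_mul_of_nonneg_left (hCclow _ _) hρ).trans (hconstr t ht)
    have h2 := mul_le_mul_of_nonneg_left hb hρ
    have h3 : rhobar t ≤ max (r (xbar t)) 0 / η := (le_div_iff₀ hη).2 h1
    have h4 : rhobar t * (1 / (2 * L1) * (M1 * M2)) ≤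
        max (r (xbar t)) 0 / η * (1 / (2 * L1) * (M1 * M2)) :=
      mul_le_mul_of_nonneg_right h3 (by positivity)
    have h5 : max (r (xbar t)) 0 / η * (1 / (2 * L1) * (M1 * M2)) =
        (M1 * M2 / (2 * L1 * η)) * max (r (xbar t)) 0 := by
      field_simp
    linarith
  intro t ht
  have h := aux_ode (fun s => r (xbar s)) _ _ hf hK h0 t ht
  exact ⟨h, lt_of_lt_of_le (by positivity) h⟩
end

section
/- Let d ≥ 1, let r : ℝ^d → ℝ and C : ℝ^d × ℝ^d → ℝ be continuously differentiable with C symmetric, i.e. C(x,y) = C(y,x) for all x, y. Let x̄ : [0,∞) → ℝ^d and ρ̄ : [0,∞) → (0,∞) be continuously differentiable, suppose the constraint r(x̄(t)) = ρ̄(t)·C(x̄(t), x̄(t)) holds for all t ≥ 0, and suppose x̄'(t) = A(t)·(∇r(x̄(t)) − ρ̄(t)·∇ₓC(x̄(t), x̄(t))), where for each t the matrix A(t) is symmetric positive definite. Then for all t ≥ 0, d/dt [ρ̄(t)²·C(x̄(t), x̄(t))] = 2ρ̄(t)·⟨x̄'(t), A(t)⁻¹·x̄'(t)⟩ ≥ 0;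 in particular t ↦ ρ̄(t)²·C(x̄(t), x̄(t)) is nondecreasing. -/
open scoped RealInnerProductSpace

/-- Lyapunov / gradient-flow structure for the local-competition model
with symmetric kernel. Under the constraint `r(x̄(t)) = ρ̄(t)C(x̄(t),x̄(t))` and the
canonical equation `x̄' = A(t)(∇r − ρ̄∇ₓC)` with `A(t)` symmetric positive definite,
one has `d/dt [ρ̄²C(x̄,x̄)] = 2ρ̄⟨x̄', A(t)⁻¹x̄'⟩ ≥ 0`, so `ρ̄²C(x̄,x̄)` is nondecreasing. -/
theorem lyapunov_local_competition (d : ℕ) (hd : 1 ≤ d)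
    (r : EuclideanSpace ℝ (Fin d) → ℝ) (hr : ContDiff ℝ 1 r)
    (Cc : EuclideanSpace ℝ (Fin d) → EuclideanSpace ℝ (Fin d) → ℝ)
    (hCc : ContDiff ℝ 1 (Function.uncurry Cc))
    (hsymm : ∀ x y, Cc x y = Cc y x)
    (xbar : ℝ → EuclideanSpace ℝ (Fin d)) (hxbar : ContDiff ℝ 1 xbar)
    (rhobar : ℝ → ℝ) (hrhobar : ContDiff ℝ 1 rhobar)
    (hrhopos : ∀ t ≥ (0:ℝ), 0 < rhobar t)
    (hconstr : ∀ t ≥ (0:ℝ), r (xbar t) = rhobar t * Cc (xbar t) (xbar t))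
    (A : ℝ → Matrix (Fin d) (Fin d) ℝ)
    (hA : ∀ t ≥ (0:ℝ), (A t).PosDef)
    (hcano : ∀ t ≥ (0:ℝ), deriv xbar t =
      Matrix.toEuclideanLin (A t)
        (gradient r (xbar t) -
          rhobar t • gradient (fun z => Cc z (xbar t)) (xbar t))) :
    (∀ t ≥ (0:ℝ),
      deriv (fun s => (rhobar s) ^ 2 * Cc (xbar s) (xbar s)) t =
        2 * rhobar t * ⟪deriv xbar t, Matrix.toEuclideanLin (A t)⁻¹ (deriv xbar t)⟫ ∧
      0 ≤ deriv (fun s => (rhobar s) ^ 2 * Cc (xbar s) (xbar s)) t) ∧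
    MonotoneOn (fun t => (rhobar t) ^ 2 * Cc (xbar t) (xbar t)) (Set.Ici 0) := by
  have key : ∀ t ≥ (0:ℝ),
      deriv (fun s => (rhobar s) ^ 2 * Cc (xbar s) (xbar s)) t =
        2 * rhobar t * ⟪deriv xbar t, Matrix.toEuclideanLin (A t)⁻¹ (deriv xbar t)⟫ ∧
      0 ≤ deriv (fun s => (rhobar s) ^ 2 * Cc (xbar s) (xbar s)) t := by
    intro t ht
    have hx : HasDerivAt xbar (deriv xbar t) t :=
      (hxbar.differentiable one_ne_zero t).hasDerivAt
    have hρ : HasDerivAt rhobar (deriv rhobar t) t :=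
      (hrhobar.differentiable one_ne_zero t).hasDerivAt
    have hrd : HasFDerivAt r (fderiv ℝ r (xbar t)) (xbar t) :=
      (hr.differentiable one_ne_zero _).hasFDerivAt
    obtain ⟨L, hL⟩ : ∃ L, HasFDerivAt (Function.uncurry Cc) L (xbar t, xbar t) :=
      ⟨_, (hCc.differentiable one_ne_zero _).hasFDerivAt⟩
    have hsw : ∀ v, L (0, v) = L (v, 0) := by
      intro v
      have h1 : HasFDerivAt (fun p : EuclideanSpace ℝ (Fin d) × EuclideanSpace ℝ (Fin d) =>
          Function.uncurry Cc (p.2, p.1))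
          (L.comp ((ContinuousLinearMap.snd ℝ _ _).prod (ContinuousLinearMap.fst ℝ _ _)))
          (xbar t, xbar t) :=
        HasFDerivAt.comp (xbar t, xbar t) (g := Function.uncurry Cc) hL
          (hasFDerivAt_snd.prodMk hasFDerivAt_fst)
      have h2 : (fun p : EuclideanSpace ℝ (Fin d) × EuclideanSpace ℝ (Fin d) =>
          Function.uncurry Cc (p.2, p.1)) = Function.uncurry Cc := by
        funext p
        exact hsymm _ _
      rw [h2] at h1
      have h3 := congrArg (fun M => M (0, v)) (hL.unique h1)
      simpa using h3
    have hg : HasFDerivAt (fun z => Cc z (xbar t)) (L.comp (ContinuousLinearMap.inl ℝ _ _))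
        (xbar t) :=
      HasFDerivAt.comp (xbar t) (g := Function.uncurry Cc) (f := fun z => (z, xbar t)) hL
        (hasFDerivAt_prodMk_left _ _)
    have hc : HasDerivAt (fun s => Cc (xbar s) (xbar s))
        (2 * L (deriv xbar t, 0)) t := by
      have h := HasFDerivAt.comp_hasDerivAt t (l := Function.uncurry Cc) hL (hx.prodMk hx)
      have e : L (deriv xbar t, deriv xbar t) = 2 * L (deriv xbar t, 0) := by
        have : ((deriv xbar t, deriv xbar t) :
          EuclideanSpace ℝ (Fin d) × EuclideanSpace ℝ (Fin d))
            = (deriv xbar t, 0) + (0, deriv xbar t) := by simp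
        rw [this, map_add, hsw]; ring
      rw [e] at h
      exact h
    have hrx : HasDerivAt (fun s => r (xbar s)) (fderiv ℝ r (xbar t) (deriv xbar t)) t :=
      hrd.comp_hasDerivAt t hx
    have hrc := hρ.mul hc
    have heq : fderiv ℝ r (xbar t) (deriv xbar t) =
        deriv rhobar t * Cc (xbar t) (xbar t) + rhobar t * (2 * L (deriv xbar t, 0)) := by
      have h1 : HasDerivWithinAt (fun s => r (xbar s)) _ (Set.Ici 0) t :=
        hrc.hasDerivWithinAt.congr (fun s hs => hconstr s hs) (hconstr t ht)
      exact (uniqueDiffOn_Ici (0:ℝ) t ht).eq_deriv _ hrx.hasDerivWithinAt h1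
    obtain ⟨w, hw⟩ : ∃ w, w = gradient r (xbar t) -
          rhobar t • gradient (fun z => Cc z (xbar t)) (xbar t) := ⟨_, rfl⟩
    have hxw := hcano t ht
    rw [← hw] at hxw
    have hin : ⟪w, deriv xbar t⟫ =
        fderiv ℝ r (xbar t) (deriv xbar t) - rhobar t * L (deriv xbar t, 0) := by
      rw [hw, inner_sub_left, inner_smul_left]
      simp [gradient, hg.fderiv]
    have hD : deriv (fun s => (rhobar s) ^ 2 * Cc (xbar s) (xbar s)) t =
        2 * rhobar t * ⟪w, deriv xbar t⟫ := by
      have h := (hρ.pow 2).mul hc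
      have h' := h.deriv
      rw [hin, heq]
      refine h'.trans ?_
      simp
      ring
    have hinv : Matrix.toEuclideanLin (A t)⁻¹ (deriv xbar t) = w := by
      rw [hxw]
      have hu : IsUnit (A t).det := (hA t ht).det_pos.ne'.isUnit
      ext i
      simp [Matrix.toLpLin_apply, Matrix.mulVec_mulVec, Matrix.nonsing_inv_mul _ hu]
    have hpos : 0 ≤ ⟪w, deriv xbar t⟫ := by
      rw [hxw]
      have := (hA t ht).posSemidef.dotProduct_mulVec_nonneg w.ofLp
      simpa [Matrix.toLpLin_apply, EuclideanSpace.inner_eq_star_dotProduct,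
        dotProduct_comm] using this
    refine ⟨?_, ?_⟩
    · rw [hD, hinv, real_inner_comm]
    · rw [hD]
      have := hrhopos t ht
      positivity
  refine ⟨key, ?_⟩
  have hdiff : Differentiable ℝ (fun t => (rhobar t) ^ 2 * Cc (xbar t) (xbar t)) := by
    have h1 : Differentiable ℝ (fun t => Function.uncurry Cc (xbar t, xbar t)) :=
      (hCc.differentiable one_ne_zero).comp
        ((hxbar.differentiable one_ne_zero).prodMk (hxbar.differentiable one_ne_zero))
    exact ((hrhobar.differentiable one_ne_zero).pow 2).mul h1
  refine monotoneOn_of_deriv_nonneg (convex_Ici 0) hdiff.continuous.continuousOn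
    hdiff.differentiableOn ?_
  intro t ht
  exact (key t (interior_subset ht)).2
end

section
/- Let d ≥ 1, let r : ℝ^d → ℝ and C : ℝ^d × ℝ^d → ℝ be continuous, let ρ̄ : [0,∞) → ℝ, and let u : [0,∞) × ℝ^d → ℝ be continuously differentiable and satisfy ∂ₜu(t,x) = r(x) − ρ̄(t)·C(x, x̄(t)) + |∇ₓu(t,x)|² for all t > 0 and x ∈ ℝ^d, where x̄ : [0,∞) → ℝ^d is differentiable and satisfies, for every t ≥ 0, max_{x ∈ ℝ^d} u(t,x) = 0 = u(t, x̄(t)). Then r(x̄(t)) = ρ̄(t)·C(x̄(t), x̄(t)) for every t > 0. -/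
/-- For a `C¹` solution `u` of the constrained Hamilton–Jacobi equation
`∂ₜu = r(x) − ρ̄(t)C(x, x̄(t)) + |∇ₓu|²` whose maximum over `x` equals `0` and is
attained at the differentiable concentration point `x̄(t)`, the exact balance
`r(x̄(t)) = ρ̄(t)·C(x̄(t), x̄(t))` holds for every `t > 0`. -/
theorem constrained_HJ_local_competition_balance (d : ℕ) (hd : 1 ≤ d)
    (r : EuclideanSpace ℝ (Fin d) → ℝ) (hr : Continuous r)
    (Cc : EuclideanSpace ℝ (Fin d) → EuclideanSpace ℝ (Fin d) → ℝ)
    (hCc : Continuous (Function.uncurry Cc))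
    (rhobar : ℝ → ℝ)
    (xbar : ℝ → EuclideanSpace ℝ (Fin d))
    (hxbar : ∀ t ≥ (0:ℝ), DifferentiableAt ℝ xbar t)
    (u : ℝ × EuclideanSpace ℝ (Fin d) → ℝ) (hu : ContDiff ℝ 1 u)
    (heq : ∀ t > (0:ℝ), ∀ x, deriv (fun s => u (s, x)) t
      = r x - rhobar t * Cc x (xbar t) + ‖gradient (fun y => u (t, y)) x‖ ^ 2)
    (hmax : ∀ t ≥ (0:ℝ), (∀ x, u (t, x) ≤ 0) ∧ u (t, xbar t) = 0) :
    ∀ t > (0:ℝ), r (xbar t) = rhobar t * Cc (xbar t) (xbar t) := by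
  intro t ht
  obtain ⟨hle, h0⟩ := hmax t ht.le
  have h1 : IsLocalMax (fun s => u (s, xbar t)) t := by
    filter_upwards [lt_mem_nhds ht] with s hs
    rw [h0]
    exact (hmax s (le_of_lt hs)).1 _
  have h2 : IsLocalMax (fun y => u (t, y)) (xbar t) :=
    Filter.Eventually.of_forall fun y => by
      show u (t, y) ≤ u (t, xbar t)
      rw [h0]
      exact hle y
  have h3 := heq t ht (xbar t)
  rw [h1.deriv_eq_zero, gradient, h2.fderiv_eq_zero, map_zero, norm_zero] at h3
  linarith
end
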